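/- arXiv:1606.09387 — 3 statements merged into one kernel-verified Lean document; each statement's English description precedes it below -/
import Mathlib

section
/- (Normalization identity.) For any dimension d ≥ 1, any torus Λ = (ℤ/Lℤ)^d, any E ∈ ℝ and any ε > 0, one has 1 = ∫ dμ_J(a,b) ∏_{j∈Λ} ((E_ε − i b_j)/(E_ε − a_j)) · det[1 − J F(a,b)], where E_ε = E + iε and F(a,b) is the diagonal Λ×Λ matrix with entries F(a,b)_{jj} = 1/((E_ε − a_j)(E_ε − i b_j)). -/
open MeasureTheory Matrix Filter Set ProbabilityTheory

noncomputable section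

/-- Sites of the `d`-dimensional discrete torus `Λ = (ℤ/Lℤ)^d`. -/
abbrev Site (d L : ℕ) := Fin d → ZMod L

/-- The negative discrete Laplacian `−Δ` with periodic boundary conditions, as a matrix:
`(x, −Δ x) = Σ_{i∼j} (x_i − x_j)²`. -/
def negLap (d L : ℕ) [NeZero L] : Matrix (Site d L) (Site d L) ℝ :=
  fun i j => (if i = j then (2 * d : ℝ) else 0)
    - ∑ k : Fin d, ((if j = Function.update i k (i k + 1) then (1 : ℝ) else 0)
        + (if j = Function.update i k (i k - 1) then (1 : ℝ) else 0))

/-- The covariance `J = (−W²Δ + 1)⁻¹`. -/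
def Jmat (d L : ℕ) [NeZero L] (W : ℝ) : Matrix (Site d L) (Site d L) ℝ :=
  (W ^ 2 • negLap d L + 1)⁻¹

/-- `J⁻¹ = −W²Δ + 1`. -/
def JmatInv (d L : ℕ) [NeZero L] (W : ℝ) : Matrix (Site d L) (Site d L) ℝ :=
  W ^ 2 • negLap d L + 1

/-- The density of the normalized Gaussian measure `dμ_J(a,b)` with respect to the
Lebesgue measure on `ℝ^Λ × ℝ^Λ`:
`det[J⁻¹/(2π)] exp(−½((a, J⁻¹ a) + (b, J⁻¹ b)))`. -/
def gaussDensityJ (d L : ℕ) [NeZero L] (W : ℝ) (a b : Site d L → ℝ) : ℝ :=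
  ((2 * Real.pi)⁻¹ • JmatInv d L W).det *
    Real.exp (-(1 / 2) * ((∑ i, ∑ j, JmatInv d L W i j * (a i * a j))
      + ∑ i, ∑ j, JmatInv d L W i j * (b i * b j)))

/-- The diagonal matrix `F(a,b)` with entries `1/((E_ε − a_j)(E_ε − i b_j))`. -/
def Fmat (d L : ℕ) [NeZero L] (E ε : ℝ) (a b : Site d L → ℝ) : Matrix (Site d L) (Site d L) ℂ :=
  Matrix.diagonal fun j =>
    1 / ((((E : ℂ) + ε * Complex.I) - (a j : ℂ)) *
      (((E : ℂ) + ε * Complex.I) - Complex.I * (b j : ℂ)))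

section PolynomialGrowth

variable {ι : Type*} [Fintype ι]

/-- Continuous functions on `ℝ^ι × ℝ^ι` of at most polynomial growth. -/
def PolyBdd (f : (ι → ℝ) × (ι → ℝ) → ℂ) : Prop :=
  Continuous f ∧ ∃ (C : ℝ) (N : ℕ), 0 ≤ C ∧ ∀ p, ‖f p‖ ≤ C * (1 + ‖p‖) ^ N

lemma PolyBdd.of_le {f : (ι → ℝ) × (ι → ℝ) → ℂ} (hf : Continuous f) (C : ℝ)
    (h : ∀ p, ‖f p‖ ≤ C) : PolyBdd f :=
  ⟨hf, C, 0, (norm_nonneg _).trans (h 0), fun p => by simpa using h p⟩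

lemma PolyBdd.const (c : ℂ) : PolyBdd (fun _ : (ι → ℝ) × (ι → ℝ) => c) :=
  .of_le continuous_const ‖c‖ fun _ => le_rfl

lemma PolyBdd.mul {f g : (ι → ℝ) × (ι → ℝ) → ℂ} (hf : PolyBdd f) (hg : PolyBdd g) :
    PolyBdd (fun p => f p * g p) := by
  obtain ⟨hfc, C, N, hC, hf⟩ := hf
  obtain ⟨hgc, D, M, hD, hg⟩ := hg
  refine ⟨hfc.mul hgc, C * D, N + M, mul_nonneg hC hD, fun p => ?_⟩
  rw [norm_mul, pow_add]
  calc ‖f p‖ * ‖g p‖ ≤ (C * (1 + ‖p‖) ^ N) * (D * (1 + ‖p‖) ^ M) :=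
        mul_le_mul (hf p) (hg p) (norm_nonneg _) (by positivity)
    _ = _ := by ring

lemma PolyBdd.add {f g : (ι → ℝ) × (ι → ℝ) → ℂ} (hf : PolyBdd f) (hg : PolyBdd g) :
    PolyBdd (fun p => f p + g p) := by
  obtain ⟨hfc, C, N, hC, hf⟩ := hf
  obtain ⟨hgc, D, M, hD, hg⟩ := hg
  refine ⟨hfc.add hgc, C + D, N + M, add_nonneg hC hD, fun p => ?_⟩
  have h1 : (1 : ℝ) ≤ 1 + ‖p‖ := by linarith [norm_nonneg p]
  calc ‖f p + g p‖ ≤ ‖f p‖ + ‖g p‖ := norm_add_le _ _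
    _ ≤ C * (1 + ‖p‖) ^ N + D * (1 + ‖p‖) ^ M := add_le_add (hf p) (hg p)
    _ ≤ C * (1 + ‖p‖) ^ (N + M) + D * (1 + ‖p‖) ^ (N + M) := by
        gcongr <;> first | exact h1 | omega
    _ = _ := by ring

lemma PolyBdd.neg {f : (ι → ℝ) × (ι → ℝ) → ℂ} (hf : PolyBdd f) : PolyBdd (fun p => -f p) := by
  simpa using (PolyBdd.const (-1)).mul hf

lemma PolyBdd.sub {f g : (ι → ℝ) × (ι → ℝ) → ℂ} (hf : PolyBdd f) (hg : PolyBdd g) :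
    PolyBdd (fun p => f p - g p) := by
  simpa [sub_eq_add_neg] using hf.add hg.neg

lemma PolyBdd.pow {f : (ι → ℝ) × (ι → ℝ) → ℂ} (hf : PolyBdd f) (n : ℕ) :
    PolyBdd (fun p => f p ^ n) := by
  induction n with
  | zero => simpa using PolyBdd.const 1
  | succ n ih => simpa [pow_succ] using ih.mul hf

lemma PolyBdd.sum {κ : Type*} (s : Finset κ) {f : κ → (ι → ℝ) × (ι → ℝ) → ℂ}
    (hf : ∀ k ∈ s, PolyBdd (f k)) : PolyBdd (fun p => ∑ k ∈ s, f k p) := by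
  classical
  induction s using Finset.induction_on with
  | empty => simpa using PolyBdd.const 0
  | insert a s ha ih =>
    simp only [Finset.sum_insert ha]
    exact (hf a (by simp)).add (ih fun k hk => hf k (by simp [hk]))

lemma PolyBdd.prod {κ : Type*} (s : Finset κ) {f : κ → (ι → ℝ) × (ι → ℝ) → ℂ}
    (hf : ∀ k ∈ s, PolyBdd (f k)) : PolyBdd (fun p => ∏ k ∈ s, f k p) := by
  classical
  induction s using Finset.induction_on with
  | empty => simpa using PolyBdd.const 1
  | insert a s ha ih =>
    simp only [Finset.prod_insert ha]
    exact (hf a (by simp)).mul (ih fun k hk => hf k (by simp [hk]))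

lemma PolyBdd.det [DecidableEq ι] {M : (ι → ℝ) × (ι → ℝ) → Matrix ι ι ℂ}
    (hM : ∀ i j, PolyBdd (fun p => M p i j)) : PolyBdd (fun p => (M p).det) := by
  simp only [Matrix.det_apply']
  exact .sum _ fun σ _ => (PolyBdd.const _).mul (.prod _ fun i _ => hM _ _)

lemma PolyBdd.fst (i : ι) : PolyBdd (fun p : (ι → ℝ) × (ι → ℝ) => (p.1 i : ℂ)) := by
  refine ⟨by fun_prop, 1, 1, zero_le_one, fun p => ?_⟩
  have h1 := (norm_le_pi_norm p.1 i).trans (norm_fst_le p)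
  simp only [Complex.norm_real]
  linarith

lemma PolyBdd.snd (i : ι) : PolyBdd (fun p : (ι → ℝ) × (ι → ℝ) => (p.2 i : ℂ)) := by
  refine ⟨by fun_prop, 1, 1, zero_le_one, fun p => ?_⟩
  have h1 := (norm_le_pi_norm p.2 i).trans (norm_snd_le p)
  simp only [Complex.norm_real]
  linarith

lemma PolyBdd.norm {f : (ι → ℝ) × (ι → ℝ) → ℂ} (hf : PolyBdd f) :
    PolyBdd (fun p => (‖f p‖ : ℂ)) := by
  obtain ⟨hfc, C, N, hC, hf⟩ := hf
  exact ⟨by fun_prop, C, N, hC, fun p => by simpa using hf p⟩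

lemma polyBdd_norm : PolyBdd (fun p : (ι → ℝ) × (ι → ℝ) => (‖p‖ : ℂ)) :=
  ⟨by fun_prop, 1, 1, zero_le_one, fun p => by simp⟩

end PolynomialGrowth

section GaussianWeight

variable {ι : Type*} [Fintype ι]

/-- The unnormalized Gaussian weight with precision matrix `Q` in both variables. -/
def gaussWeight (Q : Matrix ι ι ℝ) (p : (ι → ℝ) × (ι → ℝ)) : ℝ :=
  Real.exp (-(1 / 2) * ((∑ i, ∑ j, Q i j * (p.1 i * p.1 j))
    + ∑ i, ∑ j, Q i j * (p.2 i * p.2 j)))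

lemma continuous_gaussWeight (Q : Matrix ι ι ℝ) : Continuous (gaussWeight Q) := by
  unfold gaussWeight
  fun_prop

lemma integrable_exp_neg_sum_sq {c : ℝ} (hc : 0 < c) :
    Integrable (fun p : (ι → ℝ) × (ι → ℝ) =>
      Real.exp (-c * (∑ i, p.1 i ^ 2 + ∑ i, p.2 i ^ 2))) := by
  have h : Integrable (fun a : ι → ℝ => ∏ i, Real.exp (-c * a i ^ 2)) :=
    Integrable.fintype_prod fun _ => integrable_exp_neg_mul_sq hc
  refine (h.mul_prod h).congr (.of_forall fun p => ?_)
  simp only [← Real.exp_sum, ← Real.exp_add, ← Finset.mul_sum, mul_add]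

lemma sq_norm_le_sum_sq (p : (ι → ℝ) × (ι → ℝ)) :
    ‖p‖ ^ 2 ≤ ∑ i, p.1 i ^ 2 + ∑ i, p.2 i ^ 2 := by
  have key : ∀ a : ι → ℝ, ‖a‖ ^ 2 ≤ ∑ i, a i ^ 2 := fun a => by
    have h0 : 0 ≤ ∑ i, a i ^ 2 := Finset.sum_nonneg fun i _ => sq_nonneg _
    rw [← Real.le_sqrt (norm_nonneg _) h0]
    refine (pi_norm_le_iff_of_nonneg (Real.sqrt_nonneg _)).2 fun i => ?_
    rw [Real.le_sqrt (norm_nonneg _) h0, Real.norm_eq_abs, sq_abs]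
    exact Finset.single_le_sum (f := fun i => a i ^ 2) (fun i _ => sq_nonneg _) (Finset.mem_univ i)
  have h1 := key p.1
  have h2 := key p.2
  rw [Prod.norm_def]
  rcases max_choice ‖p.1‖ ‖p.2‖ with h | h <;> rw [h] <;>
    nlinarith [sq_nonneg ‖p.1‖, sq_nonneg ‖p.2‖]

lemma one_add_pow_le_exp (x : ℝ) (hx : 0 ≤ x) (N : ℕ) :
    (1 + x) ^ N ≤ (N.factorial * Real.exp 2) * Real.exp (x ^ 2 / 4) := by
  have h := Real.pow_div_factorial_le_exp (1 + x) (by linarith) N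
  rw [div_le_iff₀ (by positivity)] at h
  refine h.trans ?_
  rw [mul_assoc, ← Real.exp_add, mul_comm]
  refine mul_le_mul_of_nonneg_left (Real.exp_le_exp.2 ?_) (Nat.cast_nonneg _)
  nlinarith [sq_nonneg (x - 2)]

lemma PolyBdd.integrable {Q : Matrix ι ι ℝ}
    (hQ : ∀ a : ι → ℝ, ∑ i, a i ^ 2 ≤ ∑ i, ∑ j, Q i j * (a i * a j))
    {f : (ι → ℝ) × (ι → ℝ) → ℂ} (hf : PolyBdd f) :
    Integrable (fun p => (gaussWeight Q p : ℂ) * f p) := by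
  obtain ⟨hfc, C, N, hC, hf⟩ := hf
  refine Integrable.mono' ((integrable_exp_neg_sum_sq (ι := ι) (c := 1 / 4) (by norm_num)).const_mul
    (C * (N.factorial * Real.exp 2)))
    ((Complex.continuous_ofReal.comp (continuous_gaussWeight Q)).mul hfc).aestronglyMeasurable
    (.of_forall fun p => ?_)
  set S := ∑ i, p.1 i ^ 2 + ∑ i, p.2 i ^ 2 with hS
  have h1 : gaussWeight Q p ≤ Real.exp (-(1 / 2) * S) := by
    unfold gaussWeight
    gcongr Real.exp ?_
    have := hQ p.1
    have := hQ p.2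
    linarith
  have h2 : ‖f p‖ ≤ C * ((N.factorial * Real.exp 2) * Real.exp (S / 4)) :=
    (hf p).trans (mul_le_mul_of_nonneg_left ((one_add_pow_le_exp _ (norm_nonneg p) N).trans
      (by gcongr; exact sq_norm_le_sum_sq p)) hC)
  have h0 : 0 ≤ gaussWeight Q p := (Real.exp_pos _).le
  rw [norm_mul, Complex.norm_real, Real.norm_of_nonneg h0]
  calc gaussWeight Q p * ‖f p‖
      ≤ Real.exp (-(1 / 2) * S) * (C * ((N.factorial * Real.exp 2) * Real.exp (S / 4))) := by gcongr
    _ = C * (N.factorial * Real.exp 2) * (Real.exp (-(1 / 2) * S) * Real.exp (S / 4)) := by ring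
    _ = C * (N.factorial * Real.exp 2) * Real.exp (-(1 / 4) * S) := by
        rw [← Real.exp_add]; congr 2; ring

/-- Gaussian integration by parts along the direction `v`. -/
lemma integral_gaussWeight_mul_lineDeriv {Q : Matrix ι ι ℝ} (hQs : ∀ i j, Q i j = Q j i)
    (hQ : ∀ a : ι → ℝ, ∑ i, a i ^ 2 ≤ ∑ i, ∑ j, Q i j * (a i * a j))
    {f f' : (ι → ℝ) × (ι → ℝ) → ℂ} (hf : PolyBdd f) (hf' : PolyBdd f')
    (v : (ι → ℝ) × (ι → ℝ)) (h : ∀ p, HasLineDerivAt ℝ f (f' p) p v) :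
    ∫ p, (gaussWeight Q p : ℂ) * f' p =
      ∫ p, (gaussWeight Q p : ℂ) * ((∑ i, ∑ j, (Q i j : ℂ) * (v.1 i * p.1 j) +
        ∑ i, ∑ j, (Q i j : ℂ) * (v.2 i * p.2 j)) * f p) := by
  have hl : PolyBdd (fun p : (ι → ℝ) × (ι → ℝ) => (∑ i, ∑ j, (Q i j : ℂ) * (v.1 i * p.1 j) +
        ∑ i, ∑ j, (Q i j : ℂ) * (v.2 i * p.2 j))) :=
    .add (.sum _ fun i _ => .sum _ fun j _ => (PolyBdd.const _).mul ((PolyBdd.const _).mul (.fst j)))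
      (.sum _ fun i _ => .sum _ fun j _ => (PolyBdd.const _).mul ((PolyBdd.const _).mul (.snd j)))
  have : (volume : Measure ((ι → ℝ) × (ι → ℝ))).IsAddHaarMeasure := by
    rw [Measure.volume_eq_prod]
    exact Measure.prod.instIsAddHaarMeasure _ _
  have key := integral_bilinear_hasLineDerivAt_right_eq_neg_left_of_integrable
    (μ := (volume : Measure ((ι → ℝ) × (ι → ℝ)))) (f := fun p => (gaussWeight Q p : ℂ))
    (f' := fun p => (gaussWeight Q p : ℂ) * -(∑ i, ∑ j, (Q i j : ℂ) * (v.1 i * p.1 j) +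
        ∑ i, ∑ j, (Q i j : ℂ) * (v.2 i * p.2 j))) (g := f) (g' := f') (v := v)
    (B := ContinuousLinearMap.mul ℝ ℂ) ?_ ?_ ?_ ?_ ?_
  · simp only [ContinuousLinearMap.mul_apply'] at key
    rw [key, ← integral_neg]
    congr 1
    ext p
    ring
  · simpa [mul_assoc] using (hl.neg.mul hf).integrable hQ
  · simpa using hf'.integrable hQ
  · simpa using hf.integrable hQ
  · intro p _
    have hquad : ∀ a w : ι → ℝ, HasDerivAt
        (fun t : ℝ => ∑ i, ∑ j, Q i j * ((a i + t * w i) * (a j + t * w j)))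
        (2 * ∑ i, ∑ j, Q i j * (w i * a j)) 0 := by
      intro a w
      have h1 : ∀ i j, HasDerivAt (fun t : ℝ => Q i j * ((a i + t * w i) * (a j + t * w j)))
          (Q i j * (w i * a j) + Q i j * (w j * a i)) 0 := by
        intro i j
        have hlin : ∀ i, HasDerivAt (fun t : ℝ => a i + t * w i) (w i) 0 := fun i => by
          simpa using ((hasDerivAt_id (0 : ℝ)).mul_const (w i)).const_add (a i)
        refine (((hlin i).mul (hlin j)).const_mul (Q i j)).congr_deriv ?_
        simp only [zero_mul, add_zero]
        ring
      refine (HasDerivAt.fun_sum fun i _ => HasDerivAt.fun_sum fun j _ => h1 i j).congr_deriv ?_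
      simp only [Finset.sum_add_distrib]
      rw [two_mul]
      congr 1
      rw [Finset.sum_comm]
      exact Finset.sum_congr rfl fun i _ => Finset.sum_congr rfl fun j _ => by rw [hQs]
    have h2 := (((hquad p.1 v.1).add (hquad p.2 v.2)).const_mul (-(1 / 2) : ℝ)).exp.ofReal_comp
    refine h2.congr_deriv ?_
    simp only [Pi.add_apply, zero_mul, add_zero, gaussWeight]
    push_cast
    ring
  · exact fun p _ => h p

/-- The total mass of the Gaussian weight. -/
lemma integral_gaussWeight [DecidableEq ι] {Q : Matrix ι ι ℝ} (hQ : Q.PosDef) :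
    (((2 * Real.pi)⁻¹ • Q).det) * ∫ p, gaussWeight Q p = 1 := by
  obtain ⟨B, hB⟩ : ∃ B : Matrix ι ι ℝ, Q = Bᵀ * B := by
    open scoped MatrixOrder in
    obtain ⟨B, -, hB⟩ := CStarAlgebra.isStrictlyPositive_iff_eq_star_mul_self.mp
      hQ.isStrictlyPositive
    exact ⟨B, by rw [hB, star_eq_conjTranspose, conjTranspose_eq_transpose_of_trivial]⟩
  have hdet : Q.det = B.det * B.det := by rw [hB, det_mul, det_transpose]
  have hB0 : B.det ≠ 0 := fun h => by
    have := hQ.det_pos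
    simp [hdet, h] at this
  have hform : ∀ a : ι → ℝ, ∑ i, ∑ j, Q i j * (a i * a j) = ∑ i, (B *ᵥ a) i ^ 2 := by
    intro a
    have h1 : a ⬝ᵥ (Q *ᵥ a) = (B *ᵥ a) ⬝ᵥ (B *ᵥ a) := by
      rw [hB, ← mulVec_mulVec, dotProduct_mulVec, vecMul_transpose]
    simp only [pow_two]
    refine Eq.trans ?_ h1
    simp only [dotProduct, mulVec, Finset.mul_sum]
    exact Finset.sum_congr rfl fun i _ => Finset.sum_congr rfl fun j _ => by ring
  have hone : ∫ a : ι → ℝ, Real.exp (-(1 / 2) * ∑ i, ∑ j, Q i j * (a i * a j)) =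
      |B.det|⁻¹ * Real.sqrt (2 * Real.pi) ^ Fintype.card ι := by
    have hmap := Real.map_matrix_volume_pi_eq_smul_volume_pi hB0
    have h2 : ∫ x : ι → ℝ, Real.exp (-(1 / 2) * ∑ i, x i ^ 2) =
        Real.sqrt (2 * Real.pi) ^ Fintype.card ι := by
      have := integral_fintype_prod_volume_eq_pow (ι := ι) (fun x : ℝ => Real.exp (-(1 / 2) * x ^ 2))
      rw [integral_gaussian] at this
      simp only [← Real.exp_sum, ← Finset.mul_sum] at this
      rw [this]
      congr 2
      ring
    have h3 : ∫ x, Real.exp (-(1 / 2) * ∑ i, x i ^ 2) ∂(Measure.map (toLin' B) volume) =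
        ∫ a : ι → ℝ, Real.exp (-(1 / 2) * ∑ i, (B *ᵥ a) i ^ 2) := by
      rw [integral_map]
      · rfl
      · exact (LinearMap.continuous_of_finiteDimensional _).measurable.aemeasurable
      · exact Continuous.aestronglyMeasurable (by fun_prop)
    simp only [hform]
    rw [← h3, hmap, integral_smul_measure, h2, ENNReal.toReal_ofReal (abs_nonneg _), abs_inv,
      smul_eq_mul]
  have hsplit : ∫ p, gaussWeight Q p =
      (∫ a : ι → ℝ, Real.exp (-(1 / 2) * ∑ i, ∑ j, Q i j * (a i * a j))) *
      ∫ a : ι → ℝ, Real.exp (-(1 / 2) * ∑ i, ∑ j, Q i j * (a i * a j)) := by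
    rw [← integral_prod_mul]
    simp only [gaussWeight, mul_add, Real.exp_add]
    rfl
  rw [hsplit, hone, det_smul, hdet]
  have hpi : (0 : ℝ) < 2 * Real.pi := by positivity
  have hs : Real.sqrt (2 * Real.pi) ^ Fintype.card ι * Real.sqrt (2 * Real.pi) ^ Fintype.card ι =
      (2 * Real.pi) ^ Fintype.card ι := by
    rw [← mul_pow, Real.mul_self_sqrt hpi.le]
  calc _ = ((2 * Real.pi)⁻¹ ^ Fintype.card ι * (Real.sqrt (2 * Real.pi) ^ Fintype.card ι *
        Real.sqrt (2 * Real.pi) ^ Fintype.card ι)) * ((B.det * B.det) * (|B.det|⁻¹ * |B.det|⁻¹)) := by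
        ring
    _ = 1 := by
        rw [hs, ← mul_pow, inv_mul_cancel₀ hpi.ne', one_pow, one_mul, ← mul_inv,
          abs_mul_abs_self, mul_inv_cancel₀ (mul_ne_zero hB0 hB0)]

end GaussianWeight

section IntegrationByParts

variable {ι : Type*} [Fintype ι] {Q : Matrix ι ι ℝ}

lemma PolyBdd.mulVec_fst (Q : Matrix ι ι ℝ) (m : ι) :
    PolyBdd (fun p : (ι → ℝ) × (ι → ℝ) => ∑ j, (Q m j : ℂ) * p.1 j) :=
  .sum _ fun j _ => (PolyBdd.const _).mul (.fst j)

lemma PolyBdd.mulVec_snd (Q : Matrix ι ι ℝ) (m : ι) :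
    PolyBdd (fun p : (ι → ℝ) × (ι → ℝ) => ∑ j, (Q m j : ℂ) * p.2 j) :=
  .sum _ fun j _ => (PolyBdd.const _).mul (.snd j)

lemma integral_gaussWeight_fst_parts [DecidableEq ι] (hQs : ∀ i j, Q i j = Q j i)
    (hQ : ∀ a : ι → ℝ, ∑ i, a i ^ 2 ≤ ∑ i, ∑ j, Q i j * (a i * a j))
    {f f' : (ι → ℝ) × (ι → ℝ) → ℂ} (hf : PolyBdd f) (hf' : PolyBdd f') (m : ι)
    (h : ∀ p, HasLineDerivAt ℝ f (f' p) p (Pi.single m 1, 0)) :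
    ∫ p, (gaussWeight Q p : ℂ) * (f' p - (∑ j, (Q m j : ℂ) * p.1 j) * f p) = 0 := by
  have key := integral_gaussWeight_mul_lineDeriv hQs hQ hf hf' _ h
  simp only [mul_sub]
  rw [integral_sub (hf'.integrable hQ) (((PolyBdd.mulVec_fst Q m).mul hf).integrable hQ), key,
    sub_eq_zero]
  congr 1
  ext p
  simp [Pi.single_apply, apply_ite, ite_mul]

lemma integral_gaussWeight_snd_parts [DecidableEq ι] (hQs : ∀ i j, Q i j = Q j i)
    (hQ : ∀ a : ι → ℝ, ∑ i, a i ^ 2 ≤ ∑ i, ∑ j, Q i j * (a i * a j))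
    {f f' : (ι → ℝ) × (ι → ℝ) → ℂ} (hf : PolyBdd f) (hf' : PolyBdd f') (m : ι)
    (h : ∀ p, HasLineDerivAt ℝ f (f' p) p (0, Pi.single m 1)) :
    ∫ p, (gaussWeight Q p : ℂ) * (f' p - (∑ j, (Q m j : ℂ) * p.2 j) * f p) = 0 := by
  have key := integral_gaussWeight_mul_lineDeriv hQs hQ hf hf' _ h
  simp only [mul_sub]
  rw [integral_sub (hf'.integrable hQ) (((PolyBdd.mulVec_snd Q m).mul hf).integrable hQ), key,
    sub_eq_zero]
  congr 1
  ext p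
  simp [Pi.single_apply, apply_ite, ite_mul]

end IntegrationByParts

section Reciprocals

variable {ι : Type*}

lemma hasDerivAt_mul_inv_sub_inv_sq {𝕜 : Type*} [NontriviallyNormedField 𝕜] [NormedAlgebra 𝕜 ℂ]
    {α β : 𝕜 → ℂ} {x y : ℂ} {t : 𝕜} (hα : HasDerivAt α x t) (hβ : HasDerivAt β y t)
    (h0 : α t ≠ 0) (m c : ℂ) :
    HasDerivAt (fun s => β s * (α s)⁻¹ * m - (α s)⁻¹ ^ 2 * c)
      (y * (α t)⁻¹ * m - x * (β t * (α t)⁻¹ ^ 2 * m) + x * (2 * (α t)⁻¹ ^ 3 * c)) t := by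
  have hi : HasDerivAt (fun s => (α s)⁻¹) (-x * (α t)⁻¹ ^ 2) t :=
    (hα.fun_inv h0).congr_deriv (by field_simp)
  refine (((hβ.mul hi).mul_const m).sub ((hi.pow 2).mul_const c)).congr_deriv ?_
  ring

lemma sub_ofReal_ne_zero {w : ℂ} (hw : 0 < w.im) (x : ℝ) : w - x ≠ 0 := fun h => by
  have := congrArg Complex.im h
  simp at this
  exact hw.ne' this

lemma norm_inv_sub_ofReal_le {w : ℂ} {r : ℝ} (hr : 0 < r) (hw : r ≤ w.im) (x : ℝ) :
    ‖(w - x)⁻¹‖ ≤ r⁻¹ := by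
  rw [norm_inv]
  refine inv_anti₀ hr ((hw.trans (le_abs_self _)).trans ?_)
  simpa using Complex.abs_im_le_norm (w - x)

lemma hasLineDerivAt_fst [DecidableEq ι] {f : (ι → ℝ) × (ι → ℝ) → ℂ}
    {z : ι → ℂ} {k : ι} (hz : 0 < (z k).im)
    (m c : (ι → ℝ) × (ι → ℝ) → ℂ)
    (hf : ∀ p, f p = (z k - Complex.I * p.2 k) * (z k - p.1 k)⁻¹ * m p
      - (z k - p.1 k)⁻¹ ^ 2 * c p)
    (hm : ∀ p (t : ℝ), m (p + t • (Pi.single k 1, 0)) = m p)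
    (hc : ∀ p (t : ℝ), c (p + t • (Pi.single k 1, 0)) = c p) (p : (ι → ℝ) × (ι → ℝ)) :
    HasLineDerivAt ℝ f ((z k - Complex.I * p.2 k) * (z k - p.1 k)⁻¹ ^ 2 * m p
      - 2 * (z k - p.1 k)⁻¹ ^ 3 * c p) p (Pi.single k 1, 0) := by
  have hα : HasDerivAt (fun t : ℝ => z k - ((p.1 k + t : ℝ) : ℂ)) (-1) 0 := by
    simpa using (((hasDerivAt_id (0 : ℝ)).const_add (p.1 k)).ofReal_comp).const_sub (z k)
  have := hasDerivAt_mul_inv_sub_inv_sq hα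
    (hasDerivAt_const (0 : ℝ) (z k - Complex.I * p.2 k)) (sub_ofReal_ne_zero hz _) (m p) (c p)
  unfold HasLineDerivAt
  simp only [hf, hm, hc]
  simp only [add_zero] at this
  have h2 := this.congr_deriv (g' := (z k - Complex.I * p.2 k) * (z k - p.1 k)⁻¹ ^ 2 * m p
      - 2 * (z k - p.1 k)⁻¹ ^ 3 * c p) (by ring)
  simpa using h2

lemma hasLineDerivAt_snd [DecidableEq ι] {f : (ι → ℝ) × (ι → ℝ) → ℂ}
    {z : ι → ℂ} {k : ι} (hz : 0 < (z k).im)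
    (m c : (ι → ℝ) × (ι → ℝ) → ℂ)
    (hf : ∀ p, f p = (z k - Complex.I * p.2 k) * (z k - p.1 k)⁻¹ * m p
      - (z k - p.1 k)⁻¹ ^ 2 * c p)
    (hm : ∀ p (t : ℝ), m (p + t • (0, Pi.single k 1)) = m p)
    (hc : ∀ p (t : ℝ), c (p + t • (0, Pi.single k 1)) = c p) (p : (ι → ℝ) × (ι → ℝ)) :
    HasLineDerivAt ℝ f (-Complex.I * (z k - p.1 k)⁻¹ * m p) p (0, Pi.single k 1) := by
  have hβ : HasDerivAt (fun t : ℝ => z k - Complex.I * ((p.2 k + t : ℝ) : ℂ)) (-Complex.I) 0 := by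
    simpa using ((((hasDerivAt_id (0 : ℝ)).const_add (p.2 k)).ofReal_comp).const_mul
      Complex.I).const_sub (z k)
  have := hasDerivAt_mul_inv_sub_inv_sq (hasDerivAt_const (0 : ℝ) (z k - p.1 k)) hβ
    (sub_ofReal_ne_zero hz _) (m p) (c p)
  unfold HasLineDerivAt
  simp only [hf, hm, hc]
  simpa using this

variable [Fintype ι]

lemma polyBdd_inv_sub {w : ℂ} (hw : 0 < w.im) (j : ι) :
    PolyBdd (fun p : (ι → ℝ) × (ι → ℝ) => (w - p.1 j)⁻¹) :=
  .of_le (Continuous.inv₀ (by fun_prop) fun p => sub_ofReal_ne_zero hw _) _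
    fun p => norm_inv_sub_ofReal_le hw le_rfl _

lemma polyBdd_sub_I_mul (w : ℂ) (j : ι) :
    PolyBdd (fun p : (ι → ℝ) × (ι → ℝ) => w - Complex.I * p.2 j) :=
  (PolyBdd.const _).sub ((PolyBdd.const _).mul (.snd j))

end Reciprocals

section Kernel

variable {ι : Type*} [DecidableEq ι]

/-- The matrix `diag(β/α) − J diag(1/α²)` with `α_j = z_j − a_j` and `β_j = z_j − i b_j`. -/
def kernelMat (J : Matrix ι ι ℝ) (z : ι → ℂ) (p : (ι → ℝ) × (ι → ℝ)) : Matrix ι ι ℂ :=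
  fun i j => (if i = j then (z j - Complex.I * p.2 j) * (z j - p.1 j)⁻¹ else 0)
    - (J i j : ℂ) * (z j - p.1 j)⁻¹ ^ 2

lemma kernelMat_updateCol_congr (J : Matrix ι ι ℝ) {z z' : ι → ℂ} {p p' : (ι → ℝ) × (ι → ℝ)}
    {k : ι} (h : ∀ j ≠ k, z j = z' j ∧ p.1 j = p'.1 j ∧ p.2 j = p'.2 j) (v : ι → ℂ) :
    (kernelMat J z p).updateCol k v = (kernelMat J z' p').updateCol k v := by
  ext i j
  by_cases hj : j = k
  · simp [hj]
  · obtain ⟨h1, h2, h3⟩ := h j hj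
    simp [updateCol_ne hj, kernelMat, h1, h2, h3]

variable [Fintype ι]

lemma det_kernelMat_eq (J : Matrix ι ι ℝ) (z : ι → ℂ) (p : (ι → ℝ) × (ι → ℝ)) (k : ι) :
    (kernelMat J z p).det =
      (z k - Complex.I * p.2 k) * (z k - p.1 k)⁻¹ *
        ((kernelMat J z p).updateCol k (Pi.single k 1)).det
      - (z k - p.1 k)⁻¹ ^ 2 * ((kernelMat J z p).updateCol k fun i => (J i k : ℂ)).det := by
  have hcol : (fun i => kernelMat J z p i k) =
      ((z k - Complex.I * p.2 k) * (z k - p.1 k)⁻¹) • (Pi.single k 1 : ι → ℂ)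
        - ((z k - p.1 k)⁻¹ ^ 2) • fun i => (J i k : ℂ) := by
    ext i
    simp only [kernelMat, Pi.sub_apply, Pi.smul_apply, Pi.single_apply, smul_eq_mul]
    split_ifs <;> ring
  conv_lhs => rw [← updateCol_eq_self (kernelMat J z p) k, hcol]
  rw [← cramer_apply, map_sub, map_smul, map_smul]
  simp [cramer_apply]

lemma polyBdd_kernelMat (J : Matrix ι ι ℝ) {z : ι → ℂ} (hz : ∀ j, 0 < (z j).im) (i j : ι) :
    PolyBdd (fun p => kernelMat J z p i j) := by
  refine PolyBdd.sub ?_ ((PolyBdd.const _).mul ((polyBdd_inv_sub (hz j) j).pow 2))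
  split_ifs
  · exact (polyBdd_sub_I_mul _ j).mul (polyBdd_inv_sub (hz j) j)
  · exact .const 0

lemma polyBdd_det_kernelMat (J : Matrix ι ι ℝ) {z : ι → ℂ} (hz : ∀ j, 0 < (z j).im) :
    PolyBdd (fun p => (kernelMat J z p).det) :=
  .det (polyBdd_kernelMat J hz)

lemma polyBdd_det_kernelMat_updateCol (J : Matrix ι ι ℝ) {z : ι → ℂ} (hz : ∀ j, 0 < (z j).im)
    (k : ι) (v : ι → ℂ) : PolyBdd (fun p => ((kernelMat J z p).updateCol k v).det) := by
  refine .det fun i j => ?_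
  simp only [updateCol_apply]
  split_ifs
  · exact .const _
  · exact polyBdd_kernelMat J hz i j

lemma det_kernelMat_updateCol_fst (J : Matrix ι ι ℝ) (z : ι → ℂ) (k : ι) (v : ι → ℂ)
    (p : (ι → ℝ) × (ι → ℝ)) (t : ℝ) :
    ((kernelMat J z (p + t • (Pi.single k 1, 0))).updateCol k v).det =
      ((kernelMat J z p).updateCol k v).det := by
  rw [kernelMat_updateCol_congr J (fun j hj => ⟨rfl, ?_, ?_⟩)] <;> simp [hj]

lemma det_kernelMat_updateCol_snd (J : Matrix ι ι ℝ) (z : ι → ℂ) (k : ι) (v : ι → ℂ)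
    (p : (ι → ℝ) × (ι → ℝ)) (t : ℝ) :
    ((kernelMat J z (p + t • (0, Pi.single k 1))).updateCol k v).det =
      ((kernelMat J z p).updateCol k v).det := by
  rw [kernelMat_updateCol_congr J (fun j hj => ⟨rfl, ?_, ?_⟩)] <;> simp [hj]

/-- The algebraic identity behind the supersymmetric cancellation: the Gaussian divergence of the
vector field `U_m = (β_m/α_m) c_m`, where `c` is obtained by Cramer's rule from the `k`-th column
of `J`, is `(α_k − β_k) det K`. -/
lemma sum_divergence_eq {Q J : Matrix ι ι ℝ} (hQs : ∀ i j, Q i j = Q j i) (hQJ : Q * J = 1)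
    {z : ι → ℂ} (hz : ∀ j, 0 < (z j).im) (k : ι) (p : (ι → ℝ) × (ι → ℝ)) (c U : ι → ℂ)
    (hc : ∀ m, c m = ((kernelMat J z p).updateCol m fun i => (J i k : ℂ)).det)
    (hU : ∀ m, U m = (z m - Complex.I * p.2 m) * (z m - p.1 m)⁻¹ * c m) :
    ∑ m, (((z m - Complex.I * p.2 m) * (z m - p.1 m)⁻¹ ^ 2 * c m
          - (∑ j, (Q m j : ℂ) * p.1 j) * U m)
        - Complex.I * (-Complex.I * (z m - p.1 m)⁻¹ * c m
          - (∑ j, (Q m j : ℂ) * p.2 j) * U m)) =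
      (Complex.I * p.2 k - p.1 k) * (kernelMat J z p).det := by
  set D := (kernelMat J z p).det with hD
  have hcr : c = cramer (kernelMat J z p) fun i => (J i k : ℂ) := funext fun m => hc m
  have hUJ : U = (J.map Complex.ofReal) *ᵥ
      (D • (Pi.single k 1 : ι → ℂ) + fun j => (z j - p.1 j)⁻¹ ^ 2 * c j) := by
    have h1 := mulVec_cramer (kernelMat J z p) fun i => (J i k : ℂ)
    rw [← hcr] at h1
    ext j
    have h2 := congrFun h1 j
    simp only [mulVec, dotProduct, kernelMat, sub_mul, Finset.sum_sub_distrib, ite_mul, zero_mul,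
      Finset.sum_ite_eq, Finset.mem_univ, if_true, Pi.smul_apply, smul_eq_mul, mul_assoc] at h2
    rw [hU]
    simp only [mulVec, dotProduct, Pi.add_apply, Pi.smul_apply, smul_eq_mul, mul_add,
      Finset.sum_add_distrib, Matrix.map_apply, Pi.single_apply, mul_ite, mul_one, mul_zero,
      Finset.sum_ite_eq', Finset.mem_univ, if_true]
    linear_combination h2
  have hQU : ∀ j, ∑ m, (Q m j : ℂ) * U m =
      (if j = k then D else 0) + (z j - p.1 j)⁻¹ ^ 2 * c j := by
    intro j
    have h1 : (Q.map Complex.ofReal) * (J.map Complex.ofReal) = 1 := by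
      have h : Q.map Complex.ofRealHom * J.map Complex.ofRealHom = 1 := by
        rw [← Matrix.map_mul, hQJ, Matrix.map_one _ (map_zero _) (map_one _)]
      exact h
    have h2 : (Q.map Complex.ofReal) *ᵥ U =
        D • (Pi.single k 1 : ι → ℂ) + fun j => (z j - p.1 j)⁻¹ ^ 2 * c j := by
      rw [hUJ, mulVec_mulVec, h1, one_mulVec]
    have h3 := congrFun h2 j
    simp only [mulVec, dotProduct, Matrix.map_apply, Pi.add_apply, Pi.smul_apply, Pi.single_apply,
      smul_eq_mul, mul_ite, mul_one, mul_zero] at h3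
    rw [← h3]
    exact Finset.sum_congr rfl fun m _ => by rw [hQs]
  have hswap : ∑ m, ((∑ j, (Q m j : ℂ) * p.1 j) * U m
      - Complex.I * ((∑ j, (Q m j : ℂ) * p.2 j) * U m)) =
      ∑ j, (p.1 j - Complex.I * p.2 j) * ∑ m, (Q m j : ℂ) * U m := by
    simp only [Finset.sum_mul, Finset.mul_sum, ← Finset.sum_sub_distrib]
    rw [Finset.sum_comm]
    exact Finset.sum_congr rfl fun i _ => Finset.sum_congr rfl fun j _ => by ring
  have hlocal : ∀ m, (z m - Complex.I * p.2 m) * (z m - p.1 m)⁻¹ ^ 2 * c m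
      - Complex.I * (-Complex.I * (z m - p.1 m)⁻¹ * c m) =
      (p.1 m - Complex.I * p.2 m) * ((z m - p.1 m)⁻¹ ^ 2 * c m) := by
    intro m
    have h0 := sub_ofReal_ne_zero (hz m) (p.1 m)
    have hI : Complex.I * -Complex.I = 1 := by simp
    field_simp
    linear_combination (-(z m - p.1 m) * c m) * hI
  calc _ = ∑ m, ((z m - Complex.I * p.2 m) * (z m - p.1 m)⁻¹ ^ 2 * c m
          - Complex.I * (-Complex.I * (z m - p.1 m)⁻¹ * c m))
        - ∑ m, ((∑ j, (Q m j : ℂ) * p.1 j) * U m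
          - Complex.I * ((∑ j, (Q m j : ℂ) * p.2 j) * U m)) := by
        rw [← Finset.sum_sub_distrib]
        exact Finset.sum_congr rfl fun m _ => by ring
    _ = _ := by
        rw [hswap]
        simp only [hlocal, hQU, mul_add, Finset.sum_add_distrib, mul_ite, mul_zero,
          Finset.sum_ite_eq', Finset.mem_univ, if_true]
        ring

end Kernel

section Normalization

variable {ι : Type*} [Fintype ι] [DecidableEq ι] {Q J : Matrix ι ι ℝ}

lemma integral_sub_mul_det_kernelMat (hQs : ∀ i j, Q i j = Q j i)
    (hQ : ∀ a : ι → ℝ, ∑ i, a i ^ 2 ≤ ∑ i, ∑ j, Q i j * (a i * a j)) (hQJ : Q * J = 1)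
    {z : ι → ℂ} (hz : ∀ j, 0 < (z j).im) (k : ι) :
    ∫ p, (gaussWeight Q p : ℂ) * ((Complex.I * p.2 k - p.1 k) * (kernelMat J z p).det) = 0 := by
  let c : ι → (ι → ℝ) × (ι → ℝ) → ℂ := fun m p =>
    ((kernelMat J z p).updateCol m fun i => (J i k : ℂ)).det
  let U : ι → (ι → ℝ) × (ι → ℝ) → ℂ := fun m p =>
    (z m - Complex.I * p.2 m) * (z m - p.1 m)⁻¹ * c m p
  let A : ι → (ι → ℝ) × (ι → ℝ) → ℂ := fun m p =>
    (z m - Complex.I * p.2 m) * (z m - p.1 m)⁻¹ ^ 2 * c m p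
  let B : ι → (ι → ℝ) × (ι → ℝ) → ℂ := fun m p => -Complex.I * (z m - p.1 m)⁻¹ * c m p
  have hc : ∀ m, PolyBdd (c m) := fun m => polyBdd_det_kernelMat_updateCol J hz m _
  have hi := fun m => polyBdd_inv_sub (hz m) m
  have hb := fun m => polyBdd_sub_I_mul (z m) m
  have hU : ∀ m, PolyBdd (U m) := fun m => ((hb m).mul (hi m)).mul (hc m)
  have hA : ∀ m, PolyBdd (A m) := fun m => ((hb m).mul ((hi m).pow 2)).mul (hc m)
  have hB : ∀ m, PolyBdd (B m) := fun m => ((PolyBdd.const _).mul (hi m)).mul (hc m)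
  have h1 : ∀ m, ∫ p, (gaussWeight Q p : ℂ) * (A m p - (∑ j, (Q m j : ℂ) * p.1 j) * U m p) = 0 :=
    fun m => integral_gaussWeight_fst_parts hQs hQ (hU m) (hA m) m fun p => by
      simpa [A] using hasLineDerivAt_fst (hz m) (c m) (fun _ => 0) (f := U m)
        (fun p => by simp [U]) (fun p t => det_kernelMat_updateCol_fst J z m _ p t)
        (fun _ _ => rfl) p
  have h2 : ∀ m, ∫ p, (gaussWeight Q p : ℂ) * (B m p - (∑ j, (Q m j : ℂ) * p.2 j) * U m p) = 0 :=
    fun m => integral_gaussWeight_snd_parts hQs hQ (hU m) (hB m) m fun p =>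
      hasLineDerivAt_snd (hz m) (c m) (fun _ => 0) (f := U m)
        (fun p => by simp [U]) (fun p t => det_kernelMat_updateCol_snd J z m _ p t)
        (fun _ _ => rfl) p
  have i1 := fun m => ((hA m).sub ((PolyBdd.mulVec_fst Q m).mul (hU m))).integrable hQ
  have i2 := fun m => ((hB m).sub ((PolyBdd.mulVec_snd Q m).mul (hU m))).integrable hQ
  have i3 : ∀ m, Integrable fun p =>
      (gaussWeight Q p : ℂ) * (A m p - (∑ j, (Q m j : ℂ) * p.1 j) * U m p)
        - Complex.I * ((gaussWeight Q p : ℂ) *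
          (B m p - (∑ j, (Q m j : ℂ) * p.2 j) * U m p)) :=
    fun m => (i1 m).sub ((i2 m).const_mul _)
  calc _ = ∫ p, ∑ m, ((gaussWeight Q p : ℂ) * (A m p - (∑ j, (Q m j : ℂ) * p.1 j) * U m p)
        - Complex.I * ((gaussWeight Q p : ℂ) *
          (B m p - (∑ j, (Q m j : ℂ) * p.2 j) * U m p))) := by
        congr 1
        ext p
        rw [← sum_divergence_eq hQs hQJ hz k p (fun m => c m p) (fun m => U m p)
          (fun _ => rfl) (fun _ => rfl), Finset.mul_sum]
        exact Finset.sum_congr rfl fun m _ => by simp only [A, B]; ring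
    _ = 0 := by
        rw [integral_finsetSum _ fun m _ => i3 m]
        refine Finset.sum_eq_zero fun m _ => ?_
        rw [integral_sub (i1 m) ((i2 m).const_mul _), integral_const_mul, h1, h2]
        simp

lemma hasDerivAt_integral_det_kernelMat (hQs : ∀ i j, Q i j = Q j i)
    (hQ : ∀ a : ι → ℝ, ∑ i, a i ^ 2 ≤ ∑ i, ∑ j, Q i j * (a i * a j)) (hQJ : Q * J = 1)
    {z : ι → ℂ} (hz : ∀ j, 0 < (z j).im) (k : ι) :
    HasDerivAt (fun w => ∫ p, (gaussWeight Q p : ℂ) * (kernelMat J (Function.update z k w) p).det)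
      0 (z k) := by
  let m : (ι → ℝ) × (ι → ℝ) → ℂ := fun p => ((kernelMat J z p).updateCol k (Pi.single k 1)).det
  let c : (ι → ℝ) × (ι → ℝ) → ℂ := fun p =>
    ((kernelMat J z p).updateCol k fun i => (J i k : ℂ)).det
  have hm : PolyBdd m := polyBdd_det_kernelMat_updateCol J hz k _
  have hc : PolyBdd c := polyBdd_det_kernelMat_updateCol J hz k _
  have hdet : ∀ w p, (kernelMat J (Function.update z k w) p).det =
      (w - Complex.I * p.2 k) * (w - p.1 k)⁻¹ * m p - (w - p.1 k)⁻¹ ^ 2 * c p := by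
    intro w p
    have hcongr := fun v => kernelMat_updateCol_congr J (z := Function.update z k w) (z' := z)
      (p := p) (p' := p) (k := k) (fun j hj => ⟨Function.update_of_ne hj _ _, rfl, rfl⟩) v
    rw [det_kernelMat_eq J _ p k, hcongr, hcongr, Function.update_self]
  have hdet0 : ∀ p, (kernelMat J z p).det =
      (z k - Complex.I * p.2 k) * (z k - p.1 k)⁻¹ * m p - (z k - p.1 k)⁻¹ ^ 2 * c p := fun p => by
    simpa using hdet (z k) p
  let F' : ℂ → (ι → ℝ) × (ι → ℝ) → ℂ := fun w p =>
    1 * (w - p.1 k)⁻¹ * m p - 1 * ((w - Complex.I * p.2 k) * (w - p.1 k)⁻¹ ^ 2 * m p)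
      + 1 * (2 * (w - p.1 k)⁻¹ ^ 3 * c p)
  have hderiv : ∀ w : ℂ, 0 < w.im → ∀ p, HasDerivAt
      (fun w => (gaussWeight Q p : ℂ) * (kernelMat J (Function.update z k w) p).det)
      ((gaussWeight Q p : ℂ) * F' w p) w := by
    intro w hw p
    simp only [hdet]
    exact (hasDerivAt_mul_inv_sub_inv_sq ((hasDerivAt_id w).sub_const _)
      ((hasDerivAt_id w).sub_const _) (sub_ofReal_ne_zero hw _) (m p) (c p)).const_mul _
  set r := (z k).im / 2 with hr
  have hr0 : 0 < r := half_pos (hz k)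
  let g : (ι → ℝ) × (ι → ℝ) → ℝ := fun p =>
    r⁻¹ * ‖m p‖ + (‖z k‖ + r + ‖p‖) * r⁻¹ ^ 2 * ‖m p‖ + 2 * r⁻¹ ^ 3 * ‖c p‖
  have hg : PolyBdd (fun p => (g p : ℂ)) := by
    simp only [g]
    push_cast
    exact (((PolyBdd.const _).mul hm.norm).add
      ((((PolyBdd.const (‖z k‖ + r)).add polyBdd_norm).mul (.const _)).mul hm.norm)).add
      ((PolyBdd.const _).mul hc.norm)
  have hball : ∀ w ∈ Metric.ball (z k) r, r ≤ w.im ∧ ‖w‖ ≤ ‖z k‖ + r := by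
    intro w hw
    rw [mem_ball_iff_norm] at hw
    have h1 := (Complex.abs_im_le_norm (w - z k)).trans hw.le
    rw [Complex.sub_im, abs_le] at h1
    have h2 := norm_le_norm_add_norm_sub' w (z k)
    constructor <;> linarith
  have hF'0 : PolyBdd (F' (z k)) :=
    ((((PolyBdd.const 1).mul (polyBdd_inv_sub (hz k) k)).mul hm).sub ((PolyBdd.const 1).mul
      (((polyBdd_sub_I_mul _ k).mul ((polyBdd_inv_sub (hz k) k).pow 2)).mul hm))).add
      ((PolyBdd.const 1).mul (((PolyBdd.const 2).mul ((polyBdd_inv_sub (hz k) k).pow 3)).mul hc))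
  have him : ∀ w ∈ Metric.ball (z k) r, ∀ j, 0 < (Function.update z k w j).im := by
    intro w hw j
    by_cases hj : j = k
    · subst hj
      simpa using hr0.trans_le (hball w hw).1
    · simpa [hj] using hz j
  have key := (hasDerivAt_integral_of_dominated_loc_of_deriv_le
    (F := fun w p => (gaussWeight Q p : ℂ) * (kernelMat J (Function.update z k w) p).det)
    (F' := fun w p => (gaussWeight Q p : ℂ) * F' w p) (x₀ := z k)
    (bound := fun p => ‖(gaussWeight Q p : ℂ) * (g p : ℂ)‖) (Metric.ball_mem_nhds (z k) hr0)
    (Filter.eventually_of_mem (Metric.ball_mem_nhds (z k) hr0) fun w hw =>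
      ((polyBdd_det_kernelMat J (him w hw)).integrable hQ).aestronglyMeasurable)
    (by simpa using (polyBdd_det_kernelMat J hz).integrable hQ)
    (hF'0.integrable hQ).aestronglyMeasurable
    (.of_forall fun p w hw => ?_) (hg.integrable hQ).norm
    (.of_forall fun p w hw => hderiv w (hr0.trans_le (hball w hw).1) p)).2
  · refine key.congr_deriv ?_
    let A : (ι → ℝ) × (ι → ℝ) → ℂ := fun p =>
      (z k - Complex.I * p.2 k) * (z k - p.1 k)⁻¹ ^ 2 * m p - 2 * (z k - p.1 k)⁻¹ ^ 3 * c p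
    let B : (ι → ℝ) × (ι → ℝ) → ℂ := fun p => -Complex.I * (z k - p.1 k)⁻¹ * m p
    have hi := polyBdd_inv_sub (hz k) k
    have hA : PolyBdd A := (((polyBdd_sub_I_mul _ k).mul (hi.pow 2)).mul hm).sub
      (((PolyBdd.const 2).mul (hi.pow 3)).mul hc)
    have hB : PolyBdd B := ((PolyBdd.const _).mul hi).mul hm
    have hD := polyBdd_det_kernelMat J hz
    have h1 : ∫ p, (gaussWeight Q p : ℂ) *
        (A p - (∑ j, (Q k j : ℂ) * p.1 j) * (kernelMat J z p).det) = 0 :=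
      integral_gaussWeight_fst_parts hQs hQ hD hA k
        (hasLineDerivAt_fst (hz k) m c hdet0
          (fun p t => det_kernelMat_updateCol_fst J z k _ p t)
          (fun p t => det_kernelMat_updateCol_fst J z k _ p t))
    have h2 : ∫ p, (gaussWeight Q p : ℂ) *
        (B p - (∑ j, (Q k j : ℂ) * p.2 j) * (kernelMat J z p).det) = 0 :=
      integral_gaussWeight_snd_parts hQs hQ hD hB k
        (hasLineDerivAt_snd (hz k) m c hdet0
          (fun p t => det_kernelMat_updateCol_snd J z k _ p t)
          (fun p t => det_kernelMat_updateCol_snd J z k _ p t))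
    have h3 := integral_sub_mul_det_kernelMat hQs hQ hQJ hz
    have i1 := (hA.sub ((PolyBdd.mulVec_fst Q k).mul hD)).integrable hQ
    have i2 := (hB.sub ((PolyBdd.mulVec_snd Q k).mul hD)).integrable hQ
    have i3 := fun l : ι =>
      ((((PolyBdd.const Complex.I).mul (.snd l)).sub (.fst l)).mul hD).integrable hQ
    have i4 : Integrable fun p => Complex.I * ((gaussWeight Q p : ℂ) *
          (B p - (∑ j, (Q k j : ℂ) * p.2 j) * (kernelMat J z p).det))
        - (gaussWeight Q p : ℂ) * (A p - (∑ j, (Q k j : ℂ) * p.1 j) * (kernelMat J z p).det) :=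
      (i2.const_mul _).sub i1
    have i5 : Integrable fun p => ∑ l, (Q k l : ℂ) * ((gaussWeight Q p : ℂ) *
        ((Complex.I * p.2 l - p.1 l) * (kernelMat J z p).det)) :=
      integrable_finsetSum _ fun l _ => (i3 l).const_mul _
    calc _ = ∫ p, ((Complex.I * ((gaussWeight Q p : ℂ) *
            (B p - (∑ j, (Q k j : ℂ) * p.2 j) * (kernelMat J z p).det))
          - (gaussWeight Q p : ℂ) * (A p - (∑ j, (Q k j : ℂ) * p.1 j) * (kernelMat J z p).det))
          + ∑ l, (Q k l : ℂ) * ((gaussWeight Q p : ℂ) *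
            ((Complex.I * p.2 l - p.1 l) * (kernelMat J z p).det))) := by
          congr 1
          ext p
          have hs : ∑ l, (Q k l : ℂ) * ((gaussWeight Q p : ℂ) *
              ((Complex.I * p.2 l - p.1 l) * (kernelMat J z p).det)) =
              (gaussWeight Q p : ℂ) * (kernelMat J z p).det *
              (Complex.I * (∑ j, (Q k j : ℂ) * p.2 j) - ∑ j, (Q k j : ℂ) * p.1 j) := by
            simp only [Finset.mul_sum, ← Finset.sum_sub_distrib]
            exact Finset.sum_congr rfl fun l _ => by ring
          rw [hs]
          simp only [F', A, B]
          have hI : Complex.I * -Complex.I = 1 := by simp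
          linear_combination (-(gaussWeight Q p : ℂ) * (z k - p.1 k)⁻¹ * m p) * hI
      _ = 0 := by
          rw [integral_add i4 i5, integral_sub (i2.const_mul _) i1, integral_const_mul, h1, h2,
            integral_finsetSum _ fun l _ => (i3 l).const_mul _]
          simp [integral_const_mul, h3]
  · obtain ⟨hw1, hw2⟩ := hball w hw
    have hinv := norm_inv_sub_ofReal_le hr0 hw1 (p.1 k)
    have hb : ‖w - Complex.I * p.2 k‖ ≤ ‖z k‖ + r + ‖p‖ := by
      refine (norm_sub_le _ _).trans (add_le_add hw2 ?_)
      simpa using (norm_le_pi_norm p.2 k).trans (norm_snd_le p)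
    rw [norm_mul, norm_mul]
    refine mul_le_mul_of_nonneg_left ?_ (norm_nonneg _)
    rw [Complex.norm_real, Real.norm_eq_abs]
    refine le_trans ?_ (le_abs_self _)
    simp only [F', g, one_mul]
    refine (norm_add_le _ _).trans (add_le_add ((norm_sub_le _ _).trans (add_le_add ?_ ?_)) ?_)
    · rw [norm_mul]; gcongr
    · rw [norm_mul, norm_mul, norm_pow]; gcongr
    · rw [norm_mul, norm_mul, norm_pow, Complex.norm_ofNat]; gcongr

lemma integral_det_kernelMat_update (hQs : ∀ i j, Q i j = Q j i)
    (hQ : ∀ a : ι → ℝ, ∑ i, a i ^ 2 ≤ ∑ i, ∑ j, Q i j * (a i * a j)) (hQJ : Q * J = 1)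
    {z : ι → ℂ} (hz : ∀ j, 0 < (z j).im) (k : ι) {w : ℂ} (hw : 0 < w.im) :
    ∫ p, (gaussWeight Q p : ℂ) * (kernelMat J (Function.update z k w) p).det =
      ∫ p, (gaussWeight Q p : ℂ) * (kernelMat J z p).det := by
  have hd : ∀ v ∈ {v : ℂ | 0 < v.im}, HasDerivAt
      (fun w => ∫ p, (gaussWeight Q p : ℂ) * (kernelMat J (Function.update z k w) p).det) 0 v := by
    intro v hv
    have hz' : ∀ j, 0 < (Function.update z k v j).im := fun j => by
      by_cases hj : j = k
      · subst hj; simpa using hv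
      · simpa [hj] using hz j
    simpa using hasDerivAt_integral_det_kernelMat hQs hQ hQJ hz' k
  have := (isOpen_lt continuous_const Complex.continuous_im).is_const_of_deriv_eq_zero
    (convex_halfSpace_im_gt 0).isPreconnected
    (fun v hv => (hd v hv).differentiableAt.differentiableWithinAt)
    (fun v hv => (hd v hv).deriv) hw (hz k)
  simpa using this

lemma integral_det_kernelMat_eq (hQs : ∀ i j, Q i j = Q j i)
    (hQ : ∀ a : ι → ℝ, ∑ i, a i ^ 2 ≤ ∑ i, ∑ j, Q i j * (a i * a j)) (hQJ : Q * J = 1)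
    {z z' : ι → ℂ} (hz : ∀ j, 0 < (z j).im) (hz' : ∀ j, 0 < (z' j).im) :
    ∫ p, (gaussWeight Q p : ℂ) * (kernelMat J z' p).det =
      ∫ p, (gaussWeight Q p : ℂ) * (kernelMat J z p).det := by
  have key : ∀ s : Finset ι,
      ∫ p, (gaussWeight Q p : ℂ) * (kernelMat J (s.piecewise z' z) p).det =
        ∫ p, (gaussWeight Q p : ℂ) * (kernelMat J z p).det := by
    intro s
    induction s using Finset.induction_on with
    | empty => simp
    | insert k s _ ih =>
      rw [Finset.piecewise_insert, integral_det_kernelMat_update hQs hQ hQJ (fun j => ?_) k (hz' k),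
        ih]
      by_cases hj : j ∈ s
      · simpa [hj] using hz' j
      · simpa [hj] using hz j
  simpa using key Finset.univ

lemma tendsto_integral_det_kernelMat
    (hQ : ∀ a : ι → ℝ, ∑ i, a i ^ 2 ≤ ∑ i, ∑ j, Q i j * (a i * a j)) (J : Matrix ι ι ℝ) :
    Tendsto (fun n : ℕ => ∫ p, (gaussWeight Q p : ℂ) *
        (kernelMat J (fun _ => ((n + 1 : ℝ) : ℂ) * Complex.I) p).det) atTop
      (nhds (∫ p, (gaussWeight Q p : ℂ))) := by
  have him : ∀ n : ℕ, (n + 1 : ℝ) ≤ (((n + 1 : ℝ) : ℂ) * Complex.I).im := fun n => by simp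
  have hpos : ∀ n : ℕ, 0 < (((n + 1 : ℝ) : ℂ) * Complex.I).im := fun n =>
    lt_of_lt_of_le (by positivity) (him n)
  have hinv : ∀ (n : ℕ) (x : ℝ), ‖(((n + 1 : ℝ) : ℂ) * Complex.I - x)⁻¹‖ ≤ (n + 1 : ℝ)⁻¹ :=
    fun n x => norm_inv_sub_ofReal_le (by positivity) (him n) x
  set S := ∑ i, ∑ j, |J i j| with hS
  have hJS : ∀ i j, |J i j| ≤ S := fun i j =>
    (Finset.single_le_sum (f := fun j => |J i j|) (fun j _ => abs_nonneg _)
      (Finset.mem_univ j)).trans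
    (Finset.single_le_sum (f := fun i => ∑ j, |J i j|)
      (fun i _ => Finset.sum_nonneg fun j _ => abs_nonneg _) (Finset.mem_univ i))
  have hS0 : 0 ≤ S := Finset.sum_nonneg fun i _ => Finset.sum_nonneg fun j _ => abs_nonneg _
  let g : (ι → ℝ) × (ι → ℝ) → ℝ := fun p =>
    (Fintype.card ι).factorial * (1 + ‖p‖ + S) ^ Fintype.card ι
  have hg : PolyBdd (fun p => (g p : ℂ)) := by
    simp only [g]
    push_cast
    exact (PolyBdd.const _).mul ((((PolyBdd.const 1).add polyBdd_norm).add (.const _)).pow _)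
  refine tendsto_integral_of_dominated_convergence
    (fun p => ‖(gaussWeight Q p : ℂ) * (g p : ℂ)‖)
    (fun n => ((polyBdd_det_kernelMat J fun _ => hpos n).integrable hQ).aestronglyMeasurable)
    (hg.integrable hQ).norm (fun n => .of_forall fun p => ?_) (.of_forall fun p => ?_)
  · rw [norm_mul, norm_mul]
    refine mul_le_mul_of_nonneg_left ?_ (norm_nonneg _)
    rw [Complex.norm_real, Real.norm_eq_abs]
    refine le_trans ?_ (le_abs_self _)
    have h := Matrix.det_le (A := kernelMat J (fun _ => ((n + 1 : ℝ) : ℂ) * Complex.I) p)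
      (abv := NormedField.toAbsoluteValue ℂ) (x := 1 + ‖p‖ + S) fun i j => ?_
    · simpa [g, NormedField.toAbsoluteValue] using h
    · change ‖kernelMat J _ p i j‖ ≤ _
      have hn1 : (1 : ℝ) ≤ n + 1 := by simp
      have hi1 : (n + 1 : ℝ)⁻¹ ≤ 1 := inv_le_one_of_one_le₀ hn1
      have h1 := hinv n (p.1 j)
      refine (norm_sub_le _ _).trans (add_le_add ?_ ?_)
      · split_ifs
        · rw [norm_mul]
          have h2 : ‖((n + 1 : ℝ) : ℂ) * Complex.I - Complex.I * p.2 j‖ ≤ (n + 1) + ‖p‖ := by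
            refine (norm_sub_le _ _).trans (add_le_add ?_ ?_)
            · rw [norm_mul, Complex.norm_real, Complex.norm_I, mul_one,
                Real.norm_of_nonneg (by positivity)]
            · simpa using (norm_le_pi_norm p.2 j).trans (norm_snd_le p)
          calc _ ≤ ((n + 1) + ‖p‖) * (n + 1 : ℝ)⁻¹ := by gcongr
            _ = 1 + ‖p‖ * (n + 1 : ℝ)⁻¹ := by
                rw [add_mul, mul_inv_cancel₀ (by positivity)]
            _ ≤ 1 + ‖p‖ := by
                gcongr
                exact mul_le_of_le_one_right (norm_nonneg _) hi1
        · rw [norm_zero]; positivity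
      · rw [norm_mul, norm_pow, Complex.norm_real, Real.norm_eq_abs]
        calc _ ≤ S * 1 ^ 2 := by
              gcongr
              · exact hJS i j
              · exact h1.trans hi1
          _ = S := by ring
  · have hω : ∀ x : ℝ, Tendsto (fun n : ℕ => (((n + 1 : ℝ) : ℂ) * Complex.I - x)⁻¹) atTop
        (nhds 0) := fun x => by
      refine squeeze_zero_norm (hinv · x) ?_
      simpa using tendsto_one_div_add_atTop_nhds_zero_nat (𝕜 := ℝ)
    have hK : Tendsto (fun n : ℕ => kernelMat J (fun _ => ((n + 1 : ℝ) : ℂ) * Complex.I) p) atTop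
        (nhds 1) := by
      refine tendsto_pi_nhds.2 fun i => tendsto_pi_nhds.2 fun j => ?_
      have h1 : Tendsto (fun n : ℕ => (if i = j then
            1 + ((p.1 j : ℂ) - Complex.I * p.2 j) * (((n + 1 : ℝ) : ℂ) * Complex.I - p.1 j)⁻¹ else 0)
          - (J i j : ℂ) * (((n + 1 : ℝ) : ℂ) * Complex.I - p.1 j)⁻¹ ^ 2) atTop
          (nhds ((if i = j then 1 + ((p.1 j : ℂ) - Complex.I * p.2 j) * 0 else 0)
            - (J i j : ℂ) * 0 ^ 2)) := by
        refine Tendsto.sub ?_ (((hω _).pow 2).const_mul _)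
        split_ifs
        · exact ((hω _).const_mul _).const_add _
        · exact tendsto_const_nhds
      have h2 : (if i = j then 1 + ((p.1 j : ℂ) - Complex.I * p.2 j) * 0 else 0)
          - (J i j : ℂ) * 0 ^ 2 = (1 : Matrix ι ι ℂ) i j := by simp [Matrix.one_apply]
      rw [h2] at h1
      refine h1.congr fun n => ?_
      have h0 := sub_ofReal_ne_zero (hpos n) (p.1 j)
      simp only [kernelMat]
      congr 2
      linear_combination -(mul_inv_cancel₀ h0)
    have hdet : Tendsto (fun n : ℕ => (kernelMat J (fun _ => ((n + 1 : ℝ) : ℂ) * Complex.I) p).det)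
        atTop (nhds 1) := by
      have := (continuous_id.matrix_det (n := ι) (R := ℂ)).tendsto 1
      simp only [id, det_one] at this
      exact this.comp hK
    simpa using hdet.const_mul (gaussWeight Q p : ℂ)

lemma integral_gaussWeight_mul_det_kernelMat (hQs : ∀ i j, Q i j = Q j i)
    (hQ : ∀ a : ι → ℝ, ∑ i, a i ^ 2 ≤ ∑ i, ∑ j, Q i j * (a i * a j)) (hQJ : Q * J = 1)
    {z : ι → ℂ} (hz : ∀ j, 0 < (z j).im) :
    ∫ p, (gaussWeight Q p : ℂ) * (kernelMat J z p).det = ∫ p, (gaussWeight Q p : ℂ) := by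
  refine tendsto_nhds_unique (tendsto_const_nhds.congr fun n : ℕ => ?_)
    (tendsto_integral_det_kernelMat hQ J)
  refine (integral_det_kernelMat_eq hQs hQ hQJ hz fun _ => ?_).symm
  simpa using (by positivity : (0 : ℝ) < n + 1)

end Normalization

section Torus

lemma update_add_eq {d L : ℕ} (i : Site d L) (k : Fin d) (c : ZMod L) :
    Function.update i k (i k + c) = i + Pi.single k c := by
  ext l
  by_cases h : l = k
  · subst h; simp
  · simp [h]

lemma negLap_apply {d L : ℕ} [NeZero L] (i j : Site d L) :
    negLap d L i j = (if i = j then (2 * d : ℝ) else 0)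
      - ∑ k : Fin d, ((if j = i + Pi.single k 1 then (1 : ℝ) else 0)
        + (if j = i + Pi.single k (-1) then (1 : ℝ) else 0)) := by
  simp only [negLap, sub_eq_add_neg, update_add_eq]

lemma negLap_symm {d L : ℕ} [NeZero L] (i j : Site d L) : negLap d L i j = negLap d L j i := by
  have h : ∀ (k : Fin d) (i j : Site d L),
      j = i + Pi.single k 1 ↔ i = j + Pi.single k (-1) := fun k i j => by
    rw [Pi.single_neg, ← sub_eq_add_neg, eq_sub_iff_add_eq, eq_comm]
  rw [negLap_apply, negLap_apply]
  simp only [h _ i j, ← h _ j i, eq_comm (a := i) (b := j)]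
  simp only [add_comm]

lemma sum_negLap_mul_nonneg {d L : ℕ} [NeZero L] (a : Site d L → ℝ) :
    0 ≤ ∑ i, ∑ j, negLap d L i j * (a i * a j) := by
  have hshift : ∀ s : Site d L, ∑ i, a i * a (i + s) ≤ ∑ i, a i ^ 2 := fun s => by
    have h : ∑ i, a (i + s) ^ 2 = ∑ i, a i ^ 2 :=
      Equiv.sum_comp (Equiv.addRight s) fun i => a i ^ 2
    calc ∑ i, a i * a (i + s) ≤ ∑ i, (a i ^ 2 / 2 + a (i + s) ^ 2 / 2) :=
          Finset.sum_le_sum fun i _ => by nlinarith [sq_nonneg (a i - a (i + s))]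
      _ = ∑ i, a i ^ 2 := by
          rw [Finset.sum_add_distrib, ← Finset.sum_div, ← Finset.sum_div, h, add_halves]
  have h : ∑ i, ∑ j, negLap d L i j * (a i * a j) = 2 * d * ∑ i, a i ^ 2
      - ∑ k : Fin d, (∑ i, a i * a (i + Pi.single k 1) + ∑ i, a i * a (i + Pi.single k (-1))) := by
    simp only [negLap_apply, sub_mul, Finset.sum_sub_distrib, Finset.sum_mul, add_mul, ite_mul,
      one_mul, zero_mul, Finset.sum_add_distrib, Finset.mul_sum]
    congr 1
    · simp [pow_two]
    · congr 1
      all_goals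
        rw [Finset.sum_comm (s := (Finset.univ : Finset (Fin d)))]
        refine Finset.sum_congr rfl fun i _ => ?_
        rw [Finset.sum_comm]
        simp
  rw [h, sub_nonneg]
  calc _ ≤ ∑ _k : Fin d, (∑ i, a i ^ 2 + ∑ i, a i ^ 2) :=
        Finset.sum_le_sum fun k _ => add_le_add (hshift _) (hshift _)
    _ = _ := by simp; ring

variable (d L : ℕ) [NeZero L] (W : ℝ)

lemma JmatInv_symm (i j : Site d L) : JmatInv d L W i j = JmatInv d L W j i := by
  simp [JmatInv, negLap_symm i j, Matrix.one_apply, eq_comm]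

lemma sum_sq_le_sum_JmatInv_mul (a : Site d L → ℝ) :
    ∑ i, a i ^ 2 ≤ ∑ i, ∑ j, JmatInv d L W i j * (a i * a j) := by
  have h : ∑ i, ∑ j, JmatInv d L W i j * (a i * a j) =
      W ^ 2 * (∑ i, ∑ j, negLap d L i j * (a i * a j)) + ∑ i, a i ^ 2 := by
    simp [JmatInv, Matrix.one_apply, add_mul, Finset.sum_add_distrib, Finset.mul_sum, mul_assoc,
      pow_two]
  rw [h]
  exact le_add_of_nonneg_left (mul_nonneg (sq_nonneg W) (sum_negLap_mul_nonneg a))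

lemma posDef_JmatInv : (JmatInv d L W).PosDef := by
  refine Matrix.PosDef.of_dotProduct_mulVec_pos (Matrix.IsHermitian.ext fun i j => ?_)
    fun x hx => ?_
  · simpa using JmatInv_symm d L W j i
  · obtain ⟨i, hi⟩ := Function.ne_iff.1 hx
    have h : 0 < ∑ i, x i ^ 2 :=
      Finset.sum_pos' (fun _ _ => sq_nonneg _) ⟨i, Finset.mem_univ _,
        by simpa using pow_pos (abs_pos.2 hi) 2⟩
    refine (h.trans_le (sum_sq_le_sum_JmatInv_mul d L W x)).trans_eq ?_
    simp only [dotProduct, Matrix.mulVec, Finset.mul_sum, Pi.star_apply, star_trivial]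
    exact Finset.sum_congr rfl fun i _ => Finset.sum_congr rfl fun j _ => by ring

lemma JmatInv_mul_Jmat : JmatInv d L W * Jmat d L W = 1 :=
  Matrix.mul_nonsing_inv _ (posDef_JmatInv d L W).det_pos.ne'.isUnit

end Torus

lemma ae_snd_ne {ι : Type*} [Fintype ι] (c : ℝ) :
    ∀ᵐ p : (ι → ℝ) × (ι → ℝ), ∀ j, p.2 j ≠ c := by
  have h : ∀ᵐ b : ι → ℝ, ∀ j, b j ≠ c := ae_all_iff.2 fun j =>
    (Measure.quasiMeasurePreserving_eval (fun _ : ι => (volume : Measure ℝ)) j).ae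
      (Measure.ae_ne volume c)
  exact Measure.quasiMeasurePreserving_snd.ae h

lemma prod_div_mul_det_one_sub {ι : Type*} [Fintype ι] [DecidableEq ι] (J : Matrix ι ι ℝ)
    {z : ι → ℂ} {p : (ι → ℝ) × (ι → ℝ)} (hα : ∀ j, z j - p.1 j ≠ 0)
    (hβ : ∀ j, z j - Complex.I * p.2 j ≠ 0) :
    (∏ j, (z j - Complex.I * p.2 j) / (z j - p.1 j)) *
      (1 - J.map Complex.ofReal *
        diagonal fun j => 1 / ((z j - p.1 j) * (z j - Complex.I * p.2 j))).det =
      (kernelMat J z p).det := by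
  rw [← det_diagonal, mul_comm, ← det_mul]
  congr 1
  ext i j
  have h1 := hα j
  have h2 := hβ j
  rw [mul_diagonal, Matrix.sub_apply, mul_diagonal, Matrix.map_apply, Matrix.one_apply, kernelMat]
  split_ifs
  · field_simp
  · field_simp
    ring

/-- Normalization identity: for any `d ≥ 1`, any torus `Λ = (ℤ/Lℤ)^d`, any
`E ∈ ℝ`, `ε > 0`,
`1 = ∫ dμ_J(a,b) ∏_j ((E_ε − i b_j)/(E_ε − a_j)) det[1 − J F(a,b)]`. -/
theorem susy_normalization (d L : ℕ) [NeZero L] (hd : 1 ≤ d) (W : ℝ) (hW : 1 ≤ W)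
    (E ε : ℝ) (hε : 0 < ε) :
    (1 : ℂ) =
      ∫ p : (Site d L → ℝ) × (Site d L → ℝ),
        ((gaussDensityJ d L W p.1 p.2 : ℝ) : ℂ) *
          (∏ j, ((((E : ℂ) + ε * Complex.I) - Complex.I * (p.2 j : ℂ)) /
            (((E : ℂ) + ε * Complex.I) - (p.1 j : ℂ)))) *
          (1 - (Jmat d L W).map Complex.ofReal * Fmat d L E ε p.1 p.2).det := by
  have hz : ∀ _ : Site d L, 0 < ((E : ℂ) + ε * Complex.I).im := fun _ => by simpa using hε
  have hQ := sum_sq_le_sum_JmatInv_mul d L W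
  symm
  calc _ = ∫ p, ((((2 * Real.pi)⁻¹ • JmatInv d L W).det : ℝ) : ℂ) *
        ((gaussWeight (JmatInv d L W) p : ℂ) *
          (kernelMat (Jmat d L W) (fun _ => (E : ℂ) + ε * Complex.I) p).det) := by
        refine integral_congr_ae ?_
        filter_upwards [ae_snd_ne ε] with p hp
        rw [← prod_div_mul_det_one_sub _ (fun j => sub_ofReal_ne_zero (hz j) _) fun j h => ?_]
        · rw [show gaussDensityJ d L W p.1 p.2 = ((2 * Real.pi)⁻¹ • JmatInv d L W).det *
            gaussWeight (JmatInv d L W) p from rfl, Fmat, Complex.ofReal_mul]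
          ring
        · have := congrArg Complex.im h
          simp only [Complex.sub_im, Complex.add_im, Complex.ofReal_im, Complex.mul_im,
            Complex.ofReal_re, Complex.I_im, Complex.I_re, Complex.zero_im] at this
          exact hp j (by linarith)
    _ = 1 := by
        rw [integral_const_mul, integral_gaussWeight_mul_det_kernelMat (JmatInv_symm d L W) hQ
          (JmatInv_mul_Jmat d L W) hz, integral_complex_ofReal, ← Complex.ofReal_mul,
          integral_gaussWeight (posDef_JmatInv d L W), Complex.ofReal_one]

end
end

section
/- There exists a constant K > 0, independent of W, f and the torus size L, such that for all W ≥ 2, all L ∈ ℕ, and all 0 < f < 1/2, the determinant ratio satisfies det[C^{−1}]/det[C_f^{−1}] ≤ (1/(1−f)) · exp[(K f |Λ|/W²) · ln(W²/(1−f))], where C_f := (C^{−1} − f m_r²)^{−1}. -/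
open MeasureTheory Matrix Filter Set ProbabilityTheory

noncomputable section

/-- The eigenvalue of `negLap d L` at the momentum `p`. -/
def negLapEigenvalue {d L : ℕ} (p : Site d L) : ℝ :=
  ∑ k, (2 - 2 * Real.cos (2 * Real.pi * (p k).valMinAbs / L))

/-- The character table of `(ℤ/Lℤ)^d`. -/
def fourierMatrix (d L : ℕ) [NeZero L] : Matrix (Site d L) (Site d L) ℂ :=
  fun x p => ZMod.stdAddChar (p ⬝ᵥ x)

lemma stdAddChar_add_stdAddChar_neg {L : ℕ} [NeZero L] (a : ZMod L) :
    (ZMod.stdAddChar a + ZMod.stdAddChar (-a) : ℂ) =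
      ((2 * Real.cos (2 * Real.pi * a.valMinAbs / L) : ℝ) : ℂ) := by
  have h1 : (ZMod.stdAddChar a : ℂ) =
      Complex.exp ((2 * Real.pi * a.valMinAbs / L : ℂ) * Complex.I) := by
    conv_lhs => rw [← a.coe_valMinAbs]
    rw [ZMod.stdAddChar_coe]
    congr 1
    ring
  have h2 : (ZMod.stdAddChar (-a) : ℂ) =
      Complex.exp (-(2 * Real.pi * a.valMinAbs / L : ℂ) * Complex.I) := by
    conv_lhs => rw [← a.coe_valMinAbs, ← Int.cast_neg]
    rw [ZMod.stdAddChar_coe]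
    congr 1
    push_cast
    ring
  rw [h1, h2]
  push_cast
  rw [Complex.two_cos]

lemma fourierMatrix_update {d L : ℕ} [NeZero L] (x p : Site d L) (k : Fin d) (a : ZMod L) :
    fourierMatrix d L (Function.update x k (x k + a)) p =
      fourierMatrix d L x p * ZMod.stdAddChar (p k * a) := by
  have h : Function.update x k (x k + a) = x + Pi.single k a := by
    ext l
    by_cases hl : l = k
    · subst hl; simp
    · simp [hl]
  rw [fourierMatrix, fourierMatrix, h, dotProduct_add, dotProduct_single, AddChar.map_add_eq_mul]

lemma negLap_map_mul_fourierMatrix (d L : ℕ) [NeZero L] :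
    (negLap d L).map (Complex.ofRealHom) * fourierMatrix d L =
      fourierMatrix d L * diagonal fun p => (negLapEigenvalue p : ℂ) := by
  ext x p
  have hk (k : Fin d) : fourierMatrix d L (Function.update x k (x k + 1)) p +
      fourierMatrix d L (Function.update x k (x k - 1)) p =
        fourierMatrix d L x p *
          ((2 * Real.cos (2 * Real.pi * (p k).valMinAbs / L) : ℝ) : ℂ) := by
    rw [sub_eq_add_neg, fourierMatrix_update, fourierMatrix_update,
      ← stdAddChar_add_stdAddChar_neg]
    simp only [mul_one, mul_neg]
    ring
  have h : ((negLap d L).map (Complex.ofRealHom) * fourierMatrix d L) x p =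
      2 * d * fourierMatrix d L x p - ∑ k : Fin d,
        (fourierMatrix d L (Function.update x k (x k + 1)) p +
          fourierMatrix d L (Function.update x k (x k - 1)) p) := by
    simp only [Matrix.mul_apply, Matrix.map_apply, negLap, map_sub, map_sum, map_add, sub_mul,
      Finset.sum_sub_distrib, Finset.sum_mul, add_mul, apply_ite Complex.ofRealHom, map_zero,
      map_one, ite_mul, zero_mul, one_mul]
    congr 1
    · simp
    · rw [Finset.sum_comm]
      simp [Finset.sum_add_distrib]
  rw [h, Matrix.mul_diagonal, Finset.sum_congr rfl fun k _ => hk k, negLapEigenvalue]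
  simp only [← Finset.mul_sum, Finset.sum_sub_distrib]
  push_cast
  simp only [Finset.sum_const, Finset.card_univ, Fintype.card_fin, nsmul_eq_mul, Finset.mul_sum]
  rw [mul_sub, Finset.mul_sum]
  ring

lemma det_fourierMatrix_ne_zero (d L : ℕ) [NeZero L] : (fourierMatrix d L).det ≠ 0 := by
  have h : fourierMatrix d L * (of fun p x => ZMod.stdAddChar (-(p ⬝ᵥ x)) :
      Matrix (Site d L) (Site d L) ℂ) =
      ((L : ℂ) ^ d) • (1 : Matrix (Site d L) (Site d L) ℂ) := by
    ext x y
    have hprod (p : Site d L) : fourierMatrix d L x p * ZMod.stdAddChar (-(p ⬝ᵥ y)) =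
        ∏ k, (ZMod.stdAddChar (p k * (x k - y k)) : ℂ) := by
      rw [fourierMatrix, ← AddChar.map_add_eq_mul, ← sub_eq_add_neg, ← dotProduct_sub,
        dotProduct]
      exact map_prod (ZMod.stdAddChar (N := L)).toMonoidHom
        (fun k => Multiplicative.ofAdd (p k * (x k - y k))) Finset.univ
    rw [Matrix.mul_apply]
    simp only [of_apply]
    rw [Finset.sum_congr rfl fun p _ => hprod p,
      ← Fintype.prod_sum fun k (a : ZMod L) => (ZMod.stdAddChar (a * (x k - y k)) : ℂ)]
    simp only [AddChar.sum_mulShift _ (ZMod.isPrimitive_stdAddChar L), sub_eq_zero]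
    by_cases hxy : x = y
    · subst hxy
      simp [ZMod.card]
    · obtain ⟨k, hk⟩ := Function.ne_iff.1 hxy
      rw [Finset.prod_eq_zero (Finset.mem_univ k) (by simp [hk])]
      simp [hxy]
  intro h0
  have h1 := congrArg Matrix.det h
  rw [det_mul, h0, zero_mul, det_smul, det_one, mul_one] at h1
  exact pow_ne_zero _ (pow_ne_zero _ (Nat.cast_ne_zero.2 (NeZero.ne L))) h1.symm

lemma det_smul_negLap_add_smul_one (d L : ℕ) [NeZero L] (a c : ℝ) :
    (a • negLap d L + c • 1).det = ∏ p : Site d L, (a * negLapEigenvalue p + c) := by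
  have h : (a • negLap d L + c • 1).map Complex.ofRealHom * fourierMatrix d L =
      fourierMatrix d L * diagonal fun p => ((a * negLapEigenvalue p + c : ℝ) : ℂ) := by
    have h1 : (a • negLap d L + c • 1).map Complex.ofRealHom =
        (a : ℂ) • (negLap d L).map Complex.ofRealHom + (c : ℂ) • 1 := by
      ext i j
      by_cases hij : i = j
      · subst hij; simp
      · simp [hij]
    have h2 : (diagonal fun p : Site d L => ((a * negLapEigenvalue p + c : ℝ) : ℂ)) =
        (a : ℂ) • diagonal (fun p => (negLapEigenvalue p : ℂ)) + (c : ℂ) • 1 := by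
      ext i j
      by_cases hij : i = j
      · subst hij; simp
      · simp [hij]
    rw [h1, h2, add_mul, mul_add, smul_mul_assoc, negLap_map_mul_fourierMatrix]
    simp
  have hdet := congrArg Matrix.det h
  rw [det_mul, det_mul, det_diagonal, mul_comm] at hdet
  have h3 := mul_left_cancel₀ (det_fourierMatrix_ne_zero d L) hdet
  have h4 : ((a • negLap d L + c • 1).map Complex.ofRealHom).det =
      Complex.ofRealHom (a • negLap d L + c • 1).det := (RingHom.map_det _ _).symm
  rw [h4, ← Complex.ofReal_prod] at h3
  exact Complex.ofReal_injective h3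

lemma two_sub_two_mul_cos_valMinAbs_ge {L : ℕ} [NeZero L] (a : ZMod L) :
    16 / (L : ℝ) ^ 2 * (a.valMinAbs.natAbs : ℝ) ^ 2 ≤
      2 - 2 * Real.cos (2 * Real.pi * a.valMinAbs / L) := by
  have hL : (0 : ℝ) < L := Nat.cast_pos.2 (NeZero.pos L)
  have habs : ((a.valMinAbs.natAbs : ℕ) : ℝ) = |(a.valMinAbs : ℝ)| := by
    rw [Nat.cast_natAbs, Int.cast_abs]
  have h2 : 2 * |(a.valMinAbs : ℝ)| ≤ L := by
    have := a.natAbs_valMinAbs_le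
    rw [← habs]
    exact_mod_cast (by omega : 2 * a.valMinAbs.natAbs ≤ L)
  have h3 : |2 * Real.pi * a.valMinAbs / L| ≤ Real.pi := by
    rw [abs_div, abs_mul, abs_of_pos Real.two_pi_pos, abs_of_pos hL, div_le_iff₀ hL]
    nlinarith [Real.pi_pos]
  have h4 := Real.cos_le_one_sub_mul_cos_sq h3
  have h5 : 2 / Real.pi ^ 2 * (2 * Real.pi * a.valMinAbs / L) ^ 2 =
      8 / (L : ℝ) ^ 2 * (a.valMinAbs : ℝ) ^ 2 := by
    field_simp
    ring
  rw [habs, sq_abs]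
  rw [h5] at h4
  have h6 : 16 / (L : ℝ) ^ 2 * (a.valMinAbs : ℝ) ^ 2 =
    2 * (8 / (L : ℝ) ^ 2 * (a.valMinAbs : ℝ) ^ 2) := by ring
  linarith

/-- The sup-norm of a point of the two-dimensional torus, using centred representatives. -/
def torusNorm {L : ℕ} (p : Site 2 L) : ℕ :=
  max (p 0).valMinAbs.natAbs (p 1).valMinAbs.natAbs

lemma torusNorm_eq_zero {L : ℕ} {p : Site 2 L} : torusNorm p = 0 ↔ p = 0 := by
  simp [torusNorm, funext_iff, Fin.forall_fin_two]

lemma negLapEigenvalue_ge {L : ℕ} [NeZero L] (p : Site 2 L) :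
    (torusNorm p : ℝ) ^ 2 / (L : ℝ) ^ 2 ≤ negLapEigenvalue p := by
  have h0 := two_sub_two_mul_cos_valMinAbs_ge (p 0)
  have h1 := two_sub_two_mul_cos_valMinAbs_ge (p 1)
  rw [negLapEigenvalue, Fin.sum_univ_two]
  have hc : (0 : ℝ) ≤ 1 / (L : ℝ) ^ 2 := by positivity
  have e (y : ℝ) : 16 / (L : ℝ) ^ 2 * y = 1 / (L : ℝ) ^ 2 * (16 * y) := by ring
  rw [e] at h0 h1
  refine le_trans ?_ (add_le_add h0 h1)
  rw [div_eq_mul_one_div, mul_comm, ← mul_add]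
  refine mul_le_mul_of_nonneg_left ?_ hc
  rw [torusNorm]
  rcases max_cases (p 0).valMinAbs.natAbs (p 1).valMinAbs.natAbs with ⟨h, _⟩ | ⟨h, _⟩ <;> rw [h] <;>
    nlinarith [sq_nonneg ((p 0).valMinAbs.natAbs : ℝ), sq_nonneg ((p 1).valMinAbs.natAbs : ℝ)]

lemma card_torusNorm_eq_le {L : ℕ} [NeZero L] {n : ℕ} (hn : n ≠ 0) :
    (Finset.univ.filter fun p : Site 2 L => torusNorm p = n).card ≤ 8 * n := by
  rw [← Int.card_box hn]
  refine Finset.card_le_card_of_injOn (fun p => ((p 0).valMinAbs, (p 1).valMinAbs)) ?_ ?_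
  · intro p hp
    exact Int.mem_box.2 (Finset.mem_filter.1 hp).2
  · intro p _ q _ h
    simpa [funext_iff, Fin.forall_fin_two] using h

lemma sum_torusNorm_le {L : ℕ} [NeZero L] {g : ℕ → ℝ} (hg : ∀ n, 0 ≤ g n) :
    ∑ p ∈ Finset.univ.erase (0 : Site 2 L), g (torusNorm p) ≤
      ∑ n ∈ Finset.range L, 8 * (n + 1 : ℝ) * g (n + 1) := by
  have hmaps : ∀ p ∈ Finset.univ.erase (0 : Site 2 L), torusNorm p - 1 ∈ Finset.range L := by
    intro p _
    have h0 := (p 0).natAbs_valMinAbs_le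
    have h1 := (p 1).natAbs_valMinAbs_le
    have := NeZero.pos L
    rw [Finset.mem_range, torusNorm]
    omega
  rw [← Finset.sum_fiberwise_of_maps_to hmaps]
  refine Finset.sum_le_sum fun n _ => ?_
  have hn : ∀ p ∈ (Finset.univ.erase (0 : Site 2 L)).filter (fun p => torusNorm p - 1 = n),
      torusNorm p = n + 1 := by
    intro p hp
    simp only [Finset.mem_filter, Finset.mem_erase, Finset.mem_univ, and_true] at hp
    have := mt torusNorm_eq_zero.1 hp.1
    omega
  rw [Finset.sum_congr rfl fun p hp => by rw [hn p hp], Finset.sum_const, nsmul_eq_mul]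
  refine mul_le_mul_of_nonneg_right ?_ (hg _)
  have := (Finset.card_le_card fun p hp => Finset.mem_filter.2 ⟨Finset.mem_univ p, hn p hp⟩).trans
    (card_torusNorm_eq_le n.succ_ne_zero)
  exact_mod_cast this

lemma sum_div_sq_add_le_log {a : ℝ} (ha : 0 < a) (N : ℕ) :
    ∑ n ∈ Finset.range N, (n + 1 : ℝ) / ((n + 1 : ℝ) ^ 2 + a) ≤
      Real.log (((N : ℝ) ^ 2 + a) / a) := by
  induction N with
  | zero => simp [ha.ne']
  | succ N ih =>
    rw [Finset.sum_range_succ]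
    have hN : 0 < (N : ℝ) ^ 2 + a := by positivity
    have hN1 : 0 < (N + 1 : ℝ) ^ 2 + a := by positivity
    have h := Real.one_sub_inv_le_log_of_pos (div_pos hN1 hN)
    rw [Real.log_div hN1.ne' hN.ne', inv_div] at h
    rw [Real.log_div hN.ne' ha.ne'] at ih
    push_cast
    rw [Real.log_div hN1.ne' ha.ne']
    have h2 : (N + 1 : ℝ) / ((N + 1 : ℝ) ^ 2 + a) ≤
        1 - ((N : ℝ) ^ 2 + a) / ((N + 1 : ℝ) ^ 2 + a) := by
      rw [one_sub_div hN1.ne']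
      gcongr
      nlinarith [(Nat.cast_nonneg N : (0 : ℝ) ≤ N)]
    linarith

lemma log_one_add_sq_div_le {c W f : ℝ} (hc : 0 < c) (hc1 : c ≤ 1) (hW : 2 ≤ W)
    (hf : 0 < f) (hf1 : f < 1 / 2) :
    Real.log (1 + W ^ 2 / c) ≤ (1 + Real.log (2 / c)) * Real.log (W ^ 2 / (1 - f)) := by
  have hW2 : 4 ≤ W ^ 2 := by nlinarith
  have hl1 : 1 ≤ Real.log (W ^ 2) := by
    rw [Real.le_log_iff_exp_le (by positivity)]
    linarith [Real.exp_one_lt_d9]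
  have hl2 : Real.log (W ^ 2) ≤ Real.log (W ^ 2 / (1 - f)) := by
    refine Real.log_le_log (by positivity) ?_
    rw [le_div_iff₀ (by linarith)]
    nlinarith
  have hlc : 0 ≤ Real.log (2 / c) := Real.log_nonneg (by rw [le_div_iff₀ hc]; linarith)
  have h : Real.log (1 + W ^ 2 / c) ≤ Real.log (W ^ 2) + Real.log (2 / c) := by
    rw [← Real.log_mul (by positivity) (by positivity)]
    refine Real.log_le_log (by positivity) ?_
    have : 1 ≤ W ^ 2 / c := by rw [le_div_iff₀ hc]; linarith
    calc 1 + W ^ 2 / c ≤ 2 * (W ^ 2 / c) := by linarith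
      _ = W ^ 2 * (2 / c) := by ring
  nlinarith

lemma sum_inv_eigenvalue_le {L : ℕ} [NeZero L] {c W f : ℝ} (hc : 0 < c) (hc1 : c ≤ 1)
    (hW : 2 ≤ W) (hf : 0 < f) (hf1 : f < 1 / 2) :
    ∑ p ∈ Finset.univ.erase (0 : Site 2 L), (W ^ 2 * negLapEigenvalue p + c)⁻¹ ≤
      8 * ((L : ℝ) ^ 2 / W ^ 2) *
        ((1 + Real.log (2 / c)) * Real.log (W ^ 2 / (1 - f))) := by
  have hL : (0 : ℝ) < L := Nat.cast_pos.2 (NeZero.pos L)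
  have hW0 : 0 < W := by linarith
  set a : ℝ := c * (L : ℝ) ^ 2 / W ^ 2 with ha
  have ha0 : 0 < a := by positivity
  calc ∑ p ∈ Finset.univ.erase (0 : Site 2 L), (W ^ 2 * negLapEigenvalue p + c)⁻¹
      ≤ ∑ p ∈ Finset.univ.erase (0 : Site 2 L),
          (L : ℝ) ^ 2 / W ^ 2 * ((torusNorm p : ℝ) ^ 2 + a)⁻¹ := by
        refine Finset.sum_le_sum fun p _ => ?_
        have h : (L : ℝ) ^ 2 / W ^ 2 * ((torusNorm p : ℝ) ^ 2 + a)⁻¹ =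
            (W ^ 2 * ((torusNorm p : ℝ) ^ 2 / (L : ℝ) ^ 2) + c)⁻¹ := by
          rw [ha]
          field_simp
        rw [h]
        gcongr
        exact negLapEigenvalue_ge p
    _ ≤ ∑ n ∈ Finset.range L, 8 * (n + 1 : ℝ) *
          ((L : ℝ) ^ 2 / W ^ 2 * (((n + 1 : ℕ) : ℝ) ^ 2 + a)⁻¹) :=
        sum_torusNorm_le (g := fun n => (L : ℝ) ^ 2 / W ^ 2 * ((n : ℝ) ^ 2 + a)⁻¹)
          fun n => by positivity
    _ = 8 * ((L : ℝ) ^ 2 / W ^ 2) *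
          ∑ n ∈ Finset.range L, (n + 1 : ℝ) / ((n + 1 : ℝ) ^ 2 + a) := by
        rw [Finset.mul_sum]
        refine Finset.sum_congr rfl fun n _ => ?_
        push_cast
        ring
    _ ≤ 8 * ((L : ℝ) ^ 2 / W ^ 2) * Real.log (1 + W ^ 2 / c) := by
        have h : 1 + W ^ 2 / c = ((L : ℝ) ^ 2 + a) / a := by
          rw [ha]
          field_simp
          ring
        rw [h]
        gcongr
        exact sum_div_sq_add_le_log ha0 L
    _ ≤ _ := by
        gcongr
        exact log_one_add_sq_div_le hc hc1 hW hf hf1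

/-- Bound on the normalization-change determinant ratio: with
`C⁻¹ = −W²Δ + m_r²` and `C_f⁻¹ = C⁻¹ − f m_r² = −W²Δ + (1−f) m_r²` (`m_r² = 2(1−E²/4)`),
there is `K > 0` independent of `W`, `f` and the torus size `L` such that for all `W ≥ 2`,
all `L` and all `0 < f < 1/2`,
`det(C⁻¹)/det(C_f⁻¹) ≤ (1−f)⁻¹ exp[(K f |Λ|/W²) ln(W²/(1−f))]`. -/
theorem det_ratio_bound (E : ℝ) (hE : |E| < 2) :
    ∃ K : ℝ, 0 < K ∧
      ∀ W : ℝ, 2 ≤ W → ∀ (L : ℕ) [NeZero L], ∀ f : ℝ, 0 < f → f < 1 / 2 →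
        (W ^ 2 • negLap 2 L + (2 * (1 - E ^ 2 / 4)) • 1).det /
            (W ^ 2 • negLap 2 L + ((1 - f) * (2 * (1 - E ^ 2 / 4))) • 1).det ≤
          (1 - f)⁻¹ *
            Real.exp (K * f * (Fintype.card (Site 2 L)) / W ^ 2 *
              Real.log (W ^ 2 / (1 - f))) := by
  set m : ℝ := 2 * (1 - E ^ 2 / 4) with hm
  have hm0 : 0 < m := by nlinarith [sq_lt_sq' (abs_lt.1 hE).1 (abs_lt.1 hE).2]
  have hm2 : m ≤ 2 := by nlinarith [sq_nonneg E]
  have hlog : 0 ≤ Real.log (2 / (m / 2)) :=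
    Real.log_nonneg (by rw [le_div_iff₀ (by positivity)]; linarith)
  refine ⟨8 * m * (1 + Real.log (2 / (m / 2))), by positivity, ?_⟩
  intro W hW L _ f hf hf1
  have hf2 : 0 < 1 - f := by linarith
  have heig (p : Site 2 L) : 0 ≤ negLapEigenvalue p :=
    le_trans (by positivity) (negLapEigenvalue_ge p)
  have heig0 : negLapEigenvalue (0 : Site 2 L) = 0 := by simp [negLapEigenvalue]
  rw [det_smul_negLap_add_smul_one, det_smul_negLap_add_smul_one, ← Finset.prod_div_distrib,
    ← Finset.mul_prod_erase _ _ (Finset.mem_univ (0 : Site 2 L)), heig0]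
  have hfirst : (W ^ 2 * 0 + m) / (W ^ 2 * 0 + (1 - f) * m) = (1 - f)⁻¹ := by
    field_simp
    simp
  rw [hfirst]
  refine mul_le_mul_of_nonneg_left ?_ (by positivity)
  calc ∏ p ∈ Finset.univ.erase (0 : Site 2 L),
        (W ^ 2 * negLapEigenvalue p + m) / (W ^ 2 * negLapEigenvalue p + (1 - f) * m)
      ≤ ∏ p ∈ Finset.univ.erase (0 : Site 2 L),
          Real.exp (f * m * (W ^ 2 * negLapEigenvalue p + m / 2)⁻¹) := by
        refine Finset.prod_le_prod (fun p _ => ?_) fun p _ => ?_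
        · have := heig p
          positivity
        · have hp := heig p
          have hden : 0 < W ^ 2 * negLapEigenvalue p + (1 - f) * m := by positivity
          have h1 : (W ^ 2 * negLapEigenvalue p + m) /
              (W ^ 2 * negLapEigenvalue p + (1 - f) * m) =
                f * m * (W ^ 2 * negLapEigenvalue p + (1 - f) * m)⁻¹ + 1 := by
            field_simp
            ring
          rw [h1]
          refine le_trans ?_ (Real.add_one_le_exp _)
          gcongr
          nlinarith
    _ = Real.exp (f * m * ∑ p ∈ Finset.univ.erase (0 : Site 2 L),
          (W ^ 2 * negLapEigenvalue p + m / 2)⁻¹) := by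
        rw [← Real.exp_sum, Finset.mul_sum]
    _ ≤ _ := by
        refine Real.exp_le_exp.2 ?_
        refine (mul_le_mul_of_nonneg_left (sum_inv_eigenvalue_le (by positivity) (by linarith) hW
          hf hf1) (by positivity)).trans_eq ?_
        simp only [Fintype.card_fun, ZMod.card, Fintype.card_fin]
        push_cast
        ring

end
end

section
/- (Real part of restricted inverse.) Let C ∈ ℝ^{N×N} be a real symmetric matrix such that C^{−1} ≥ c·Id as a quadratic form for some c > 0, let m ∈ ℝ, and set B := (C^{−1} + i m·Id)^{−1} ∈ ℂ^{N×N}. Then for any subset Y ⊂ {1,…,N}, the principal submatrix B_Y of B on the index set Y is invertible and Re((B_Y)^{−1}) ≥ c·Id_Y as a quadratic form on ℝ^Y. -/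
open Matrix

section Accretive

variable {n l : Type*} [Fintype n] [DecidableEq n] [Fintype l]

/-- A complex matrix with strictly positive numerical real part is invertible. -/
lemma isUnit_det_of_le_re_dotProduct_mulVec {c : ℝ} (hc : 0 < c) {A : Matrix n n ℂ}
    (hA : ∀ w : n → ℂ, c * ∑ i, ‖w i‖ ^ 2 ≤ (star w ⬝ᵥ A *ᵥ w).re) : IsUnit A.det := by
  rw [← Matrix.isUnit_iff_isUnit_det, ← Matrix.mulVec_injective_iff_isUnit,
    ← Matrix.coe_mulVecLin, injective_iff_map_eq_zero]
  intro w hw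
  have h := hA w
  rw [Matrix.mulVecLin_apply] at hw
  rw [hw, dotProduct_zero, Complex.zero_re] at h
  have h0 : ∑ i, ‖w i‖ ^ 2 = 0 :=
    le_antisymm (nonpos_of_mul_nonpos_right h hc) (Finset.sum_nonneg fun i _ => sq_nonneg _)
  rw [Finset.sum_eq_zero_iff_of_nonneg fun i _ => sq_nonneg _] at h0
  funext i
  simpa using h0 i (Finset.mem_univ i)

/-- The column inclusion along `f` composed with a dot product is restriction along `f`. -/
lemma dotProduct_one_submatrix_mulVec (f : l → n) (w : n → ℂ) (u : l → ℂ) :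
    w ⬝ᵥ ((1 : Matrix n n ℂ).submatrix id f *ᵥ u) = (w ∘ f) ⬝ᵥ u := by
  rw [dotProduct_mulVec]
  congr 1
  funext j
  simp [vecMul, dotProduct, Matrix.one_apply]

lemma submatrix_mulVec_eq_comp (f : l → n) (B : Matrix n n ℂ) (u : l → ℂ) :
    B.submatrix f f *ᵥ u = (B *ᵥ ((1 : Matrix n n ℂ).submatrix id f *ᵥ u)) ∘ f := by
  funext i
  exact (dotProduct_one_submatrix_mulVec f (B (f i)) u).symm

variable [DecidableEq l] in
/-- The lower bound on the numerical real part of `A` passes to the inverse of any principal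
submatrix of `A⁻¹`. -/
lemma le_re_dotProduct_inv_submatrix_inv {c : ℝ} (hc : 0 < c) {A : Matrix n n ℂ}
    (hA : ∀ w : n → ℂ, c * ∑ i, ‖w i‖ ^ 2 ≤ (star w ⬝ᵥ A *ᵥ w).re)
    {f : l → n} (hf : Function.Injective f) :
    IsUnit (A⁻¹.submatrix f f).det ∧
      ∀ v : l → ℂ, c * ∑ i, ‖v i‖ ^ 2 ≤ (star v ⬝ᵥ (A⁻¹.submatrix f f)⁻¹ *ᵥ v).re := by
  have hAu := isUnit_det_of_le_re_dotProduct_mulVec hc hA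
  have key (u : l → ℂ) :
      c * ∑ i, ‖(A⁻¹ *ᵥ ((1 : Matrix n n ℂ).submatrix id f *ᵥ u)) i‖ ^ 2 ≤
        (star (A⁻¹.submatrix f f *ᵥ u) ⬝ᵥ u).re := by
    have h := hA (A⁻¹ *ᵥ ((1 : Matrix n n ℂ).submatrix id f *ᵥ u))
    rw [Matrix.mulVec_mulVec _ A, Matrix.mul_nonsing_inv _ hAu, Matrix.one_mulVec,
      dotProduct_one_submatrix_mulVec] at h
    rwa [submatrix_mulVec_eq_comp]
  have hunit : IsUnit (A⁻¹.submatrix f f).det := by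
    rw [← Matrix.isUnit_iff_isUnit_det, ← Matrix.mulVec_injective_iff_isUnit,
      ← Matrix.coe_mulVecLin, injective_iff_map_eq_zero]
    intro u hu
    rw [Matrix.mulVecLin_apply] at hu
    have h := key u
    rw [hu, star_zero, zero_dotProduct, Complex.zero_re] at h
    have h0 := le_antisymm (nonpos_of_mul_nonpos_right h hc)
      (Finset.sum_nonneg fun i _ => sq_nonneg _)
    rw [Finset.sum_eq_zero_iff_of_nonneg fun i _ => sq_nonneg _] at h0
    have hw : A⁻¹ *ᵥ ((1 : Matrix n n ℂ).submatrix id f *ᵥ u) = 0 := by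
      funext i
      simpa using h0 i (Finset.mem_univ i)
    have hPu : (1 : Matrix n n ℂ).submatrix id f *ᵥ u = 0 := by
      have := congrArg (A *ᵥ ·) hw
      simpa only [Matrix.mulVec_mulVec _ A, Matrix.mul_nonsing_inv _ hAu, Matrix.one_mulVec,
        Matrix.mulVec_zero] using this
    have hu1 := submatrix_mulVec_eq_comp f 1 u
    rw [Matrix.submatrix_one f hf, Matrix.one_mulVec, hPu, Matrix.mulVec_zero] at hu1
    exact hu1
  refine ⟨hunit, fun v => ?_⟩
  have h := key ((A⁻¹.submatrix f f)⁻¹ *ᵥ v)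
  have hv : A⁻¹.submatrix f f *ᵥ ((A⁻¹.submatrix f f)⁻¹ *ᵥ v) = v := by
    rw [Matrix.mulVec_mulVec, Matrix.mul_nonsing_inv _ hunit, Matrix.one_mulVec]
  rw [hv] at h
  refine le_trans (mul_le_mul_of_nonneg_left ?_ hc.le) h
  rw [submatrix_mulVec_eq_comp] at hv
  generalize A⁻¹ *ᵥ ((1 : Matrix n n ℂ).submatrix id f *ᵥ ((A⁻¹.submatrix f f)⁻¹ *ᵥ v)) = w at hv
  subst hv
  calc ∑ i, ‖(w ∘ f) i‖ ^ 2 = ∑ i ∈ Finset.univ.map ⟨f, hf⟩, ‖w i‖ ^ 2 := by simp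
    _ ≤ ∑ i, ‖w i‖ ^ 2 :=
      Finset.sum_le_sum_of_subset_of_nonneg (Finset.subset_univ _) fun i _ _ => sq_nonneg _

/-- Adding an imaginary multiple of the identity to a real matrix does not change the lower bound
on its quadratic form. -/
lemma le_re_dotProduct_ofReal_add_smul_one {c : ℝ} {S : Matrix n n ℝ}
    (hS : ∀ v : n → ℝ, c * ∑ i, v i ^ 2 ≤ ∑ i, ∑ j, v i * S i j * v j) (m : ℝ) (w : n → ℂ) :
    c * ∑ i, ‖w i‖ ^ 2 ≤
      (star w ⬝ᵥ (S.map Complex.ofReal + ((m : ℂ) * Complex.I) • 1) *ᵥ w).re := by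
  have hre : (star w ⬝ᵥ (S.map Complex.ofReal + ((m : ℂ) * Complex.I) • 1) *ᵥ w).re =
      ∑ i, ∑ j, (w i).re * S i j * (w j).re + ∑ i, ∑ j, (w i).im * S i j * (w j).im := by
    rw [Matrix.add_mulVec, Matrix.smul_mulVec, Matrix.one_mulVec, dotProduct_add, dotProduct_smul,
      Complex.add_re]
    have him : (((m : ℂ) * Complex.I) • (star w ⬝ᵥ w)).re = 0 := by
      simp only [dotProduct, Finset.smul_sum, Complex.re_sum]
      refine Finset.sum_eq_zero fun i _ => ?_
      simp [mul_comm]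
    rw [him, add_zero, ← Finset.sum_add_distrib]
    simp only [dotProduct, Matrix.mulVec, Finset.mul_sum, Complex.re_sum,
      ← Finset.sum_add_distrib]
    refine Finset.sum_congr rfl fun i _ => Finset.sum_congr rfl fun j _ => ?_
    simp
    ring
  have hnorm : ∑ i, ‖w i‖ ^ 2 = ∑ i, (w i).re ^ 2 + ∑ i, (w i).im ^ 2 := by
    rw [← Finset.sum_add_distrib]
    refine Finset.sum_congr rfl fun i _ => ?_
    rw [Complex.sq_norm, Complex.normSq_apply]
    ring
  rw [hre, hnorm, mul_add]
  exact add_le_add (hS fun i => (w i).re) (hS fun i => (w i).im)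

end Accretive

/-- Real part of a restricted inverse: if `C` is real symmetric with
`C⁻¹ ≥ c·Id` (`c > 0`) and `B = (C⁻¹ + i m·Id)⁻¹`, then for any index set `Y` the principal
submatrix `B_Y` is invertible and `Re((B_Y)⁻¹) ≥ c·Id_Y` as a quadratic form. -/
theorem restricted_inverse_real_part (N : ℕ) (C : Matrix (Fin N) (Fin N) ℝ)
    (hCsymm : C.IsSymm) (hCunit : IsUnit C.det) (c : ℝ) (hc : 0 < c)
    (hquad : ∀ v : Fin N → ℝ, c * ∑ i, v i ^ 2 ≤ ∑ i, ∑ j, v i * C⁻¹ i j * v j)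
    (m : ℝ) (Y : Finset (Fin N)) :
    IsUnit ((((C⁻¹).map Complex.ofReal + ((m : ℂ) * Complex.I) • 1)⁻¹).submatrix
        (Subtype.val : {x // x ∈ Y} → Fin N) Subtype.val).det ∧
    ∀ v : {x // x ∈ Y} → ℝ,
      c * ∑ i, v i ^ 2 ≤
        ∑ i, ∑ j, v i *
          ((((((C⁻¹).map Complex.ofReal + ((m : ℂ) * Complex.I) • 1)⁻¹).submatrix
              (Subtype.val : {x // x ∈ Y} → Fin N) Subtype.val)⁻¹ i j).re) * v j := by
  obtain ⟨hunit, hle⟩ := le_re_dotProduct_inv_submatrix_inv hc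
    (le_re_dotProduct_ofReal_add_smul_one hquad m)
    (Subtype.val_injective : Function.Injective (Subtype.val : {x // x ∈ Y} → Fin N))
  refine ⟨hunit, fun v => ?_⟩
  have h := hle fun i => (v i : ℂ)
  simpa [dotProduct, Matrix.mulVec, Finset.mul_sum, mul_assoc] using h
end
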